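/- arXiv:1303.1707 — 7 statements merged into one kernel-verified Lean document; each statement's English description precedes it below -/
import Mathlib

section
/- Suppose there exists u ∈ L¹([a,b]; ℝ^m) satisfying the linear constraints ∫_a^b g_i(t)·u(t) dt = h_i for all i = 1,…,n. Then the relaxed moment problem p* := inf { ‖μ‖_TV : μ ∈ M([a,b]; ℝ^m), ⟨g_i, μ⟩ = h_i for i = 1,…,n } attains its infimum at some vector measure μ*, and moreover p* equals the (possibly unattained) infimum q* := inf { Σ_{j=1}^m ∫_a^b |u_j(t)| dt : u ∈ L¹([a,b]; ℝ^m), ∫_a^b g_i(t)·u(t) dt = h_i for i = 1,…,n }. -/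
open MeasureTheory

attribute [local instance] MeasureTheory.Measure.Subtype.measureSpace

/-- Integral of a function against a finite signed measure, via Jordan decomposition. -/
noncomputable def sigInt {X : Type*} [MeasurableSpace X] (f : X → ℝ) (μ : SignedMeasure X) : ℝ :=
  (∫ t, f t ∂μ.toJordanDecomposition.posPart) - ∫ t, f t ∂μ.toJordanDecomposition.negPart

/-- Total variation norm of an m-vector of finite signed measures. -/
noncomputable def tvn {X : Type*} [MeasurableSpace X] {m : ℕ} (μ : Fin m → SignedMeasure X) : ℝ :=
  ∑ j, ((μ j).totalVariation Set.univ).toReal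

/-- The duality bracket ⟨g_i, μ⟩ = Σ_j ∫ g_{i,j} dμ_j. -/
noncomputable def bra {X : Type*} [MeasurableSpace X] {m : ℕ}
    (g : Fin m → X → ℝ) (μ : Fin m → SignedMeasure X) : ℝ :=
  ∑ j, sigInt (g j) (μ j)

section
open scoped Pointwise

open Set in
lemma aux_isCompact_convexHull {n : ℕ} {s : Set (Fin n → ℝ)} (hs : IsCompact s) :
    IsCompact (convexHull ℝ s) := by
  have key : convexHull ℝ s = ⋃ k ∈ Finset.range (n + 2),
      (fun x : (Fin k → ℝ) × (Fin k → (Fin n → ℝ)) => ∑ i, x.1 i • x.2 i) ''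
        (stdSimplex ℝ (Fin k) ×ˢ Set.pi univ (fun _ => s)) := by
    apply Subset.antisymm
    · intro x hx
      obtain ⟨ι, _, z, w, hz, hai, hw, hw1, hsum⟩ := eq_pos_convex_span_of_mem_convexHull hx
      have hcard : Fintype.card ι ≤ n + 1 := by
        refine hai.card_le_finrank_succ.trans ?_
        have := Submodule.finrank_le (vectorSpan ℝ (range z))
        simp at this
        omega
      simp only [mem_iUnion]
      let e := (Fintype.equivFin ι).symm
      refine ⟨Fintype.card ι, by simp; omega, (w ∘ e, z ∘ e), ⟨⟨fun i => (hw _).le, ?_⟩, ?_⟩, ?_⟩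
      · rw [← hw1]; exact Equiv.sum_comp e w
      · intro i _; exact hz (mem_range_self _)
      · rw [← hsum]; exact Equiv.sum_comp e (fun i => w i • z i)
    · refine iUnion₂_subset fun k _ => ?_
      rintro _ ⟨⟨w, z⟩, ⟨hw, hz⟩, rfl⟩
      exact (convex_convexHull ℝ s).sum_mem (fun i _ => hw.1 i) hw.2
        (fun i _ => subset_convexHull ℝ s (hz i (mem_univ i)))
  rw [key]
  refine Finset.isCompact_biUnion _ fun k _ => ?_
  refine ((isCompact_stdSimplex ℝ (Fin k)).prod (isCompact_univ_pi fun _ => hs)).image ?_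
  fun_prop

lemma aux_smul_add {n : ℕ} {C : Set (Fin n → ℝ)} (hC : Convex ℝ C) {r s : ℝ} (hr : 0 ≤ r)
    (hs : 0 ≤ s) {x y : Fin n → ℝ} (hx : x ∈ r • C) (hy : y ∈ s • C) : x + y ∈ (r + s) • C := by
  rw [hC.add_smul hr hs]
  exact Set.add_mem_add hx hy

lemma aux_smul_sum {n : ℕ} {C : Set (Fin n → ℝ)} (hC : Convex ℝ C) (h0 : (0 : Fin n → ℝ) ∈ C)
    {ι : Type*} (t : Finset ι) (r : ι → ℝ) (hr : ∀ j, 0 ≤ r j) (x : ι → Fin n → ℝ)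
    (hx : ∀ j, x j ∈ r j • C) : ∑ j ∈ t, x j ∈ (∑ j ∈ t, r j) • C := by
  classical
  induction t using Finset.induction_on with
  | empty => simp only [Finset.sum_empty]; exact ⟨0, h0, by simp⟩
  | insert a t ha ih =>
    rw [Finset.sum_insert ha, Finset.sum_insert ha]
    exact aux_smul_add hC (hr a) (Finset.sum_nonneg fun j _ => hr j) (hx a) ih

/-- The compact convex set of moments. -/
def auxC {X : Type*} {m n : ℕ} (g : Fin n → Fin m → X → ℝ) : Set (Fin n → ℝ) :=
  convexHull ℝ (insert 0 (⋃ j, (Set.range (fun t i => g i j t) ∪ Set.range (fun t i => - g i j t))))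

section
variable {X : Type*} [TopologicalSpace X] [CompactSpace X] [MeasurableSpace X] [BorelSpace X]
  {m n : ℕ} (g : Fin n → Fin m → X → ℝ)

lemma auxC_zero : (0 : Fin n → ℝ) ∈ auxC g := subset_convexHull ℝ _ (Set.mem_insert _ _)

lemma auxC_convex : Convex ℝ (auxC g) := convex_convexHull ℝ _

lemma auxC_compact (hg : ∀ i j, Continuous (g i j)) : IsCompact (auxC g) := by
  refine aux_isCompact_convexHull (IsCompact.insert (isCompact_iUnion fun j => ?_) _)
  refine (isCompact_range ?_).union (isCompact_range ?_)
  · exact continuous_pi fun i => hg i j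
  · exact continuous_pi fun i => (hg i j).neg

lemma aux_integral_mem (hg : ∀ i j, Continuous (g i j)) (F : X → Fin n → ℝ) (hF : Continuous F)
    (hFC : ∀ t, F t ∈ auxC g) (p : Measure X) [IsFiniteMeasure p] :
    (fun i => ∫ t, F t i ∂p) ∈ p.real Set.univ • auxC g := by
  have hint : Integrable F p := by
    exact hF.integrable_of_hasCompactSupport (HasCompactSupport.of_compactSpace F)
  have e : (fun i => ∫ t, F t i ∂p) = ∫ t, F t ∂p := by
    ext i
    exact (eval_integral (fun i => Integrable.eval hint i) i).symm
  rw [e]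
  rcases eq_or_ne p 0 with rfl | hp
  · simp only [integral_zero_measure]
    exact ⟨0, auxC_zero g, by simp⟩
  · have : NeZero p := ⟨hp⟩
    refine ⟨⨍ t, F t ∂p, (auxC_convex g).average_mem (auxC_compact g hg).isClosed
      (Filter.Eventually.of_forall hFC) hint, ?_⟩
    exact measure_smul_average p F

lemma aux_pair_mem (hg : ∀ i j, Continuous (g i j)) (p q : Fin m → Measure X)
    [∀ j, IsFiniteMeasure (p j)] [∀ j, IsFiniteMeasure (q j)] :
    (fun i => ∑ j, ((∫ t, g i j t ∂(p j)) - ∫ t, g i j t ∂(q j))) ∈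
      (∑ j, ((p j).real Set.univ + (q j).real Set.univ)) • auxC g := by
  have e : (fun i => ∑ j, ((∫ t, g i j t ∂(p j)) - ∫ t, g i j t ∂(q j))) =
      ∑ j, ((fun i => ∫ t, g i j t ∂(p j)) + (fun i => ∫ t, - g i j t ∂(q j))) := by
    ext i
    simp [integral_neg, sub_eq_add_neg]
  rw [e]
  refine aux_smul_sum (auxC_convex g) (auxC_zero g) _ _ (fun j => by positivity) _ fun j => ?_
  refine aux_smul_add (auxC_convex g) (by positivity) (by positivity) ?_ ?_
  · refine aux_integral_mem g hg (fun t i => g i j t) (continuous_pi fun i => hg i j)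
      (fun t => subset_convexHull ℝ _ (Set.mem_insert_of_mem _ ?_)) _
    exact Set.mem_iUnion.2 ⟨j, Or.inl ⟨t, rfl⟩⟩
  · refine aux_integral_mem g hg (fun t i => - g i j t) (continuous_pi fun i => (hg i j).neg)
      (fun t => subset_convexHull ℝ _ (Set.mem_insert_of_mem _ ?_)) _
    exact Set.mem_iUnion.2 ⟨j, Or.inr ⟨t, rfl⟩⟩

lemma aux_signed_mem (hg : ∀ i j, Continuous (g i j)) (μ : Fin m → SignedMeasure X) :
    (fun i => bra (g i) μ) ∈ tvn μ • auxC g := by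
  have := aux_pair_mem g hg (fun j => (μ j).toJordanDecomposition.posPart)
    (fun j => (μ j).toJordanDecomposition.negPart)
  have e : tvn μ = ∑ j, ((μ j).toJordanDecomposition.posPart.real Set.univ +
      (μ j).toJordanDecomposition.negPart.real Set.univ) := by
    unfold tvn
    refine Finset.sum_congr rfl fun j _ => ?_
    rw [SignedMeasure.totalVariation, Measure.add_apply,
      ENNReal.toReal_add (by finiteness) (by finiteness)]
    rfl
  rw [e]
  exact this

lemma aux_L1_mem (hg : ∀ i j, Continuous (g i j)) (ν : Measure X) [IsFiniteMeasure ν]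
    (u : Fin m → X → ℝ) (hu : ∀ j, Integrable (u j) ν) :
    (fun i => ∑ j, ∫ t, g i j t * u j t ∂ν) ∈ (∑ j, ∫ t, |u j t| ∂ν) • auxC g := by
  have f1 : ∀ j, IsFiniteMeasure (ν.withDensity fun t => ENNReal.ofReal (u j t)) := fun j =>
    isFiniteMeasure_withDensity_ofReal (hu j).2
  have f2 : ∀ j, IsFiniteMeasure (ν.withDensity fun t => ENNReal.ofReal (- u j t)) := fun j =>
    isFiniteMeasure_withDensity_ofReal (hu j).neg.2
  have key : ∀ (f v : X → ℝ), Integrable v ν →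
      ∫ t, f t ∂(ν.withDensity fun t => ENNReal.ofReal (v t)) = ∫ t, max (v t) 0 * f t ∂ν := by
    intro f v hv
    rw [integral_withDensity_eq_integral_toReal_smul₀ hv.1.aemeasurable.ennreal_ofReal
      (Filter.Eventually.of_forall fun t => ENNReal.ofReal_lt_top)]
    simp [ENNReal.toReal_ofReal']
  have bd : ∀ i j v, Integrable v ν → Integrable (fun t => max (v t) 0 * g i j t) ν := by
    intro i j v hv
    obtain ⟨c, hc⟩ := (isCompact_range (hg i j)).isBounded.exists_norm_le
    exact (hv.pos_part).mul_bdd (c := c) (hg i j).aestronglyMeasurable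
      (Filter.Eventually.of_forall fun t => hc _ ⟨t, rfl⟩)
  have tot : ∀ v, Integrable v ν → (ν.withDensity fun t => ENNReal.ofReal (v t)).real Set.univ
      = ∫ t, max (v t) 0 ∂ν := by
    intro v hv
    have := key (fun _ => 1) v hv
    simpa using this
  have := aux_pair_mem g hg (fun j => ν.withDensity fun t => ENNReal.ofReal (u j t))
    (fun j => ν.withDensity fun t => ENNReal.ofReal (- u j t))
  convert this using 2
  · refine Finset.sum_congr rfl fun j _ => ?_
    rw [tot _ (hu j), tot (fun t => - u j t) (hu j).neg, ← integral_add (hu j).pos_part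
      (show Integrable (fun t => max (- u j t) 0) ν from (hu j).neg.pos_part)]
    refine integral_congr_ae (Filter.Eventually.of_forall fun t => ?_)
    beta_reduce
    rcases le_total 0 (u j t) with h | h
    · rw [abs_of_nonneg h, max_eq_left h, max_eq_right (by linarith)]; ring
    · rw [abs_of_nonpos h, max_eq_right h, max_eq_left (by linarith)]; ring
  · rename_i i
    refine Finset.sum_congr rfl fun j _ => ?_
    rw [key _ _ (hu j), key _ (fun t => - u j t) (hu j).neg, ← integral_sub (bd i j _ (hu j))
      (bd i j (fun t => - u j t) (hu j).neg)]
    refine integral_congr_ae (Filter.Eventually.of_forall fun t => ?_)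
    beta_reduce
    rcases le_total 0 (u j t) with h | h
    · rw [max_eq_left h, max_eq_right (by linarith)]; ring
    · rw [max_eq_right h, max_eq_left (by linarith)]; ring

lemma aux_sub (p q : Measure X) [IsFiniteMeasure p] [IsFiniteMeasure q] :
    ((p.toSignedMeasure - q.toSignedMeasure).totalVariation Set.univ).toReal ≤
      p.real Set.univ + q.real Set.univ ∧
    ∀ f, Integrable f p → Integrable f q →
      sigInt f (p.toSignedMeasure - q.toSignedMeasure) = ∫ t, f t ∂p - ∫ t, f t ∂q := by
  constructor
  · rw [SignedMeasure.totalVariation, Measure.toJordanDecomposition_toSignedMeasure_sub,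
      Measure.add_apply, ENNReal.toReal_add (by finiteness) (by finiteness),
      Measure.jordanDecompositionOfToSignedMeasureSub_posPart,
      Measure.jordanDecompositionOfToSignedMeasureSub_negPart]
    refine add_le_add ?_ ?_
    · exact ENNReal.toReal_mono (by finiteness) (Measure.sub_le _)
    · exact ENNReal.toReal_mono (by finiteness) (Measure.sub_le _)
  · intro f hp hq
    unfold sigInt
    rw [Measure.toJordanDecomposition_toSignedMeasure_sub,
      Measure.jordanDecompositionOfToSignedMeasureSub_posPart,
      Measure.jordanDecompositionOfToSignedMeasureSub_negPart]
    have e : (p - q) + q = (q - p) + p := by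
      have := Measure.sub_toSignedMeasure_eq_toSignedMeasure_sub (μ := p) (ν := q)
      rw [← Measure.toSignedMeasure_eq_toSignedMeasure_iff, Measure.toSignedMeasure_add,
        Measure.toSignedMeasure_add]
      rw [sub_eq_sub_iff_add_eq_add] at this
      rw [← this, add_comm]
    have h1 : Integrable f (p - q) := hp.mono_measure Measure.sub_le
    have h2 : Integrable f (q - p) := hq.mono_measure Measure.sub_le
    have := congrArg (fun ρ => ∫ t, f t ∂ρ) e
    simp only [integral_add_measure h1 hq, integral_add_measure h2 hp] at this
    linarith

end

end

section
variable {X : Type*} [TopologicalSpace X] [CompactSpace X] [MeasurableSpace X] [BorelSpace X]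
  {m n : ℕ} (g : Fin n → Fin m → X → ℝ)

lemma aux_cont_int (hg : ∀ i j, Continuous (g i j)) (i : Fin n) (j : Fin m) (p : Measure X)
    [IsFiniteMeasure p] : Integrable (g i j) p :=
  (hg i j).integrable_of_hasCompactSupport (HasCompactSupport.of_compactSpace _)

lemma aux_pairs (hg : ∀ i j, Continuous (g i j)) (c : Fin n → ℝ) (hc : c ∈ auxC g) :
    ∃ p q : Fin m → Measure X, (∀ j, IsFiniteMeasure (p j)) ∧ (∀ j, IsFiniteMeasure (q j)) ∧
      (∑ j, ((p j).real Set.univ + (q j).real Set.univ)) ≤ 1 ∧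
      c = fun i => ∑ j, ((∫ t, g i j t ∂(p j)) - ∫ t, g i j t ∂(q j)) := by
  suffices H : auxC g ⊆ {c | ∃ p q : Fin m → Measure X, (∀ j, IsFiniteMeasure (p j)) ∧
      (∀ j, IsFiniteMeasure (q j)) ∧
      (∑ j, ((p j).real Set.univ + (q j).real Set.univ)) ≤ 1 ∧
      c = fun i => ∑ j, ((∫ t, g i j t ∂(p j)) - ∫ t, g i j t ∂(q j))} from H hc
  have fin1 : ∀ (j k : Fin m) (t : X), IsFiniteMeasure (if k = j then Measure.dirac t else 0) := by
    intro j k t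
    split_ifs <;> infer_instance
  refine convexHull_min ?_ ?_
  · rintro x (rfl | hx)
    · exact ⟨fun _ => 0, fun _ => 0, fun _ => inferInstance, fun _ => inferInstance,
        by simp, by ext; simp⟩
    · obtain ⟨j, ⟨t, rfl⟩ | ⟨t, rfl⟩⟩ := Set.mem_iUnion.1 hx
      · refine ⟨fun k => if k = j then Measure.dirac t else 0, fun _ => 0, fun k => fin1 j k t,
          fun _ => inferInstance, ?_, ?_⟩
        · rw [Finset.sum_eq_single j]
          · simp
          · intro k _ hk; simp [hk]
          · simp
        · ext i
          rw [Finset.sum_eq_single j]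
          · simp [integral_dirac' _ _ (hg i j).stronglyMeasurable]
          · intro k _ hk; simp [hk]
          · simp
      · refine ⟨fun _ => 0, fun k => if k = j then Measure.dirac t else 0,
          fun _ => inferInstance, fun k => fin1 j k t, ?_, ?_⟩
        · rw [Finset.sum_eq_single j]
          · simp
          · intro k _ hk; simp [hk]
          · simp
        · ext i
          rw [Finset.sum_eq_single j]
          · simp [integral_dirac' _ _ (hg i j).stronglyMeasurable]
          · intro k _ hk; simp [hk]
          · simp
  · rintro x ⟨p, q, hp, hq, h1, rfl⟩ y ⟨p', q', hp', hq', h1', rfl⟩ a b ha hb hab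
    lift a to NNReal using ha
    lift b to NNReal using hb
    refine ⟨fun j => a • p j + b • p' j, fun j => a • q j + b • q' j, fun j => inferInstance,
      fun j => inferInstance, ?_, ?_⟩
    · have e : ∀ (p q : Measure X) [IsFiniteMeasure p] [IsFiniteMeasure q],
        (a • p + b • q).real Set.univ = a * p.real Set.univ + b * q.real Set.univ := by
        intro p q _ _
        rw [measureReal_add_apply, measureReal_nnreal_smul_apply, measureReal_nnreal_smul_apply]
      calc _ = ∑ j, (a * ((p j).real Set.univ + (q j).real Set.univ)
            + b * ((p' j).real Set.univ + (q' j).real Set.univ)) := by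
            refine Finset.sum_congr rfl fun j _ => ?_
            rw [e, e]; ring
        _ ≤ 1 := by
            rw [Finset.sum_add_distrib, ← Finset.mul_sum, ← Finset.mul_sum]
            have := mul_le_mul_of_nonneg_left h1 a.2
            have := mul_le_mul_of_nonneg_left h1' b.2
            simp only [NNReal.val_eq_coe] at *
            linarith
    · ext i
      have e : ∀ j (p q : Measure X) [IsFiniteMeasure p] [IsFiniteMeasure q],
        ∫ t, g i j t ∂(a • p + b • q) = a * ∫ t, g i j t ∂p + b * ∫ t, g i j t ∂q := by
        intro j p q _ _
        rw [integral_add_measure (aux_cont_int g hg _ _ _) (aux_cont_int g hg _ _ _),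
          integral_smul_nnreal_measure, integral_smul_nnreal_measure]
        simp [NNReal.smul_def]
      simp only [Pi.add_apply, Pi.smul_apply, smul_eq_mul, Finset.mul_sum,
        ← Finset.sum_add_distrib]
      refine Finset.sum_congr rfl fun j _ => ?_
      rw [e, e]; ring

open scoped Pointwise in
lemma aux_exists_signed (hg : ∀ i j, Continuous (g i j)) (h : Fin n → ℝ) (r : ℝ) (hr : 0 ≤ r)
    (hh : h ∈ r • auxC g) :
    ∃ μ : Fin m → SignedMeasure X, (∀ i, bra (g i) μ = h i) ∧ tvn μ ≤ r := by
  obtain ⟨c, hc, rfl⟩ := hh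
  obtain ⟨p, q, hp, hq, h1, rfl⟩ := aux_pairs g hg c hc
  lift r to NNReal using hr
  refine ⟨fun j => (r • p j).toSignedMeasure - (r • q j).toSignedMeasure, fun i => ?_, ?_⟩
  · simp only [bra, Pi.smul_apply, smul_eq_mul, Finset.mul_sum]
    refine Finset.sum_congr rfl fun j _ => ?_
    rw [(aux_sub (r • p j) (r • q j)).2 _ (aux_cont_int g hg _ _ _) (aux_cont_int g hg _ _ _),
      integral_smul_nnreal_measure, integral_smul_nnreal_measure]
    simp [NNReal.smul_def, mul_sub]
  · calc tvn _ ≤ ∑ j, ((r • p j).real Set.univ + (r • q j).real Set.univ) :=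
          Finset.sum_le_sum fun j _ => (aux_sub (r • p j) (r • q j)).1
      _ = r * ∑ j, ((p j).real Set.univ + (q j).real Set.univ) := by
          rw [Finset.mul_sum]
          refine Finset.sum_congr rfl fun j _ => ?_
          rw [measureReal_nnreal_smul_apply, measureReal_nnreal_smul_apply]; ring
      _ ≤ r := by
          have := mul_le_mul_of_nonneg_left h1 r.2
          simp only [NNReal.val_eq_coe] at *
          linarith

end

open scoped Pointwise in
lemma aux_abstract {E : Type*} [AddCommGroup E] [Module ℝ E] {n : ℕ} (N : Seminorm ℝ E)
    (L : E →ₗ[ℝ] (Fin n → ℝ)) (h : Fin n → ℝ) (hL : h ∈ LinearMap.range L) (r : ℝ) (hr : 0 ≤ r)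
    (hh : h ∈ r • closure (L '' N.closedBall 0 1)) (ε : ℝ) (hε : 0 < ε) :
    ∃ u, L u = h ∧ N u ≤ r + ε := by
  obtain ⟨R, hR⟩ := LinearMap.exists_rightInverse_of_surjective L.rangeRestrict
    L.range_rangeRestrict
  have hR' : ∀ v, L (R v) = v := fun v => by
    have := congrArg Subtype.val (LinearMap.congr_fun hR v)
    simpa using this
  have hcont : Continuous (N.comp R) := by
    rw [← continuousOn_univ]
    exact (N.comp R).convexOn.continuousOn isOpen_univ
  obtain ⟨δ, hδ, hδ'⟩ := Metric.continuousAt_iff.1 (hcont.continuousAt (x := 0)) ε hε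
  obtain ⟨c, hc, rfl⟩ := hh
  obtain ⟨_, ⟨u, hu, rfl⟩, hd⟩ := Metric.mem_closure_iff.1 hc (δ / (r + 1)) (by positivity)
  have hv : r • c - r • L u ∈ LinearMap.range L :=
    Submodule.sub_mem _ hL (Submodule.smul_mem _ _ ⟨u, rfl⟩)
  refine ⟨r • u + R ⟨_, hv⟩, ?_, ?_⟩
  · rw [map_add, hR', map_smul]; simp
  · have h1 : N (R ⟨_, hv⟩) < ε := by
      have := @hδ' ⟨_, hv⟩ ?_
      · simp only [Seminorm.comp_apply, map_zero, dist_zero_right] at this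
        exact (le_abs_self _).trans_lt this
      · rw [dist_zero_right]
        change ‖r • c - r • L u‖ < δ
        rw [← smul_sub, norm_smul, Real.norm_of_nonneg hr, ← dist_eq_norm]
        rw [lt_div_iff₀ (by positivity)] at hd
        have := dist_nonneg (x := c) (y := L u)
        linarith
    have h2 : N (r • u) ≤ r := by
      rw [map_smul_eq_mul, Real.norm_of_nonneg hr]
      rw [Seminorm.mem_closedBall_zero] at hu
      nlinarith
    linarith [map_add_le_add N (r • u) (R ⟨_, hv⟩)]

section
variable {X : Type*} [TopologicalSpace X] [CompactSpace X] [MeasurableSpace X] [BorelSpace X]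
  {m n : ℕ}

/-- The space of integrable vector functions. -/
def auxE (m : ℕ) (ν : Measure X) : Submodule ℝ (Fin m → X → ℝ) where
  carrier := {u | ∀ j, Integrable (u j) ν}
  add_mem' := fun hu hv j => (hu j).add (hv j)
  zero_mem' := fun j => integrable_zero _ _ _
  smul_mem' := fun c _ hu j => (hu j).smul c

/-- The L1 seminorm. -/
noncomputable def auxN (m : ℕ) (ν : Measure X) : Seminorm ℝ (auxE m ν) :=
  Seminorm.of (fun u => ∑ j, ∫ t, |u.1 j t| ∂ν)
    (by
      intro u v
      rw [← Finset.sum_add_distrib]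
      refine Finset.sum_le_sum fun j _ => ?_
      rw [← integral_add (u.2 j).abs (v.2 j).abs]
      refine integral_mono ((u.2 j).add (v.2 j)).abs ((u.2 j).abs.add (v.2 j).abs) fun t => ?_
      exact abs_add_le _ _)
    (by
      intro c u
      rw [Finset.mul_sum]
      refine Finset.sum_congr rfl fun j _ => ?_
      rw [← integral_const_mul]
      refine integral_congr_ae (Filter.Eventually.of_forall fun t => ?_)
      exact abs_mul _ _)

lemma aux_mul_int {f : X → ℝ} (hf : Continuous f) {ν : Measure X} {v : X → ℝ}
    (hv : Integrable v ν) : Integrable (fun t => f t * v t) ν := by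
  obtain ⟨c, hc⟩ := (isCompact_range hf).isBounded.exists_norm_le
  exact hv.bdd_mul (c := c) hf.aestronglyMeasurable
    (Filter.Eventually.of_forall fun t => hc _ ⟨t, rfl⟩)

/-- The moment map. -/
noncomputable def auxL (g : Fin n → Fin m → X → ℝ) (hg : ∀ i j, Continuous (g i j))
    (ν : Measure X) : auxE m ν →ₗ[ℝ] (Fin n → ℝ) where
  toFun u := fun i => ∑ j, ∫ t, g i j t * u.1 j t ∂ν
  map_add' := by
    intro u v
    ext i
    rw [Pi.add_apply, ← Finset.sum_add_distrib]
    refine Finset.sum_congr rfl fun j _ => ?_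
    rw [← integral_add (aux_mul_int (hg i j) (u.2 j)) (aux_mul_int (hg i j) (v.2 j))]
    refine integral_congr_ae (Filter.Eventually.of_forall fun t => ?_)
    exact mul_add _ _ _
  map_smul' := by
    intro c u
    ext i
    rw [Pi.smul_apply, smul_eq_mul, Finset.mul_sum]
    refine Finset.sum_congr rfl fun j _ => ?_
    rw [← integral_const_mul]
    refine integral_congr_ae (Filter.Eventually.of_forall fun t => ?_)
    exact mul_left_comm _ _ _

lemma aux_point (g : Fin n → Fin m → X → ℝ) (hg : ∀ i j, Continuous (g i j))
    (ν : Measure X) [IsFiniteMeasure ν] [ν.IsOpenPosMeasure] (σ : ℝ) (hσ : |σ| = 1)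
    (j : Fin m) (t : X) :
    (fun i => σ * g i j t) ∈ closure (auxL g hg ν '' (auxN m ν).closedBall 0 1) := by
  rw [Metric.mem_closure_iff]
  intro ε hε
  have hev : ∀ᶠ s in nhds t, ∀ i, dist (g i j s) (g i j t) < ε / 2 := by
    rw [Filter.eventually_all]
    intro i
    exact (hg i j).continuousAt.eventually (Metric.ball_mem_nhds _ (half_pos hε))
  obtain ⟨U, hU, hUo, htU⟩ := eventually_nhds_iff.1 hev
  have hpos : 0 < ν.real U :=
    ENNReal.toReal_pos (hUo.measure_pos ν ⟨t, htU⟩).ne' (by finiteness)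
  let w : X → ℝ := U.indicator (fun _ => σ * (ν.real U)⁻¹)
  have hw : Integrable w ν := (integrable_const _).indicator hUo.measurableSet
  let u : auxE m ν := ⟨fun k => if k = j then w else 0, fun k => by
    by_cases hk : k = j
    · simpa [hk] using hw
    · simp [hk]⟩
  refine ⟨auxL g hg ν u, ⟨u, ?_, rfl⟩, ?_⟩
  · rw [Seminorm.mem_closedBall_zero]
    change ∑ k, ∫ s, |(if k = j then w else 0) s| ∂ν ≤ 1
    rw [Finset.sum_eq_single j (fun k _ hk => by simp [hk]) (by simp)]
    have e : ∀ s, |w s| = U.indicator (fun _ => (ν.real U)⁻¹) s := by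
      intro s
      by_cases hs : s ∈ U
      · simp [w, hs, abs_mul, hσ, abs_of_pos hpos]
      · simp [w, hs]
    simp only [if_true, e]
    rw [integral_indicator hUo.measurableSet]
    simp [hpos.ne']
  · have e : ∀ i, auxL g hg ν u i = σ * (ν.real U)⁻¹ * ∫ s in U, g i j s ∂ν := by
      intro i
      change ∑ k, ∫ s, g i k s * (if k = j then w else 0) s ∂ν = _
      rw [Finset.sum_eq_single j (fun k _ hk => by simp [hk]) (by simp), ← integral_const_mul,
        ← integral_indicator hUo.measurableSet]
      refine integral_congr_ae (Filter.Eventually.of_forall fun s => ?_)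
      by_cases hs : s ∈ U
      · simp [w, hs, mul_comm]
      · simp [w, hs]
    refine lt_of_le_of_lt ((dist_pi_le_iff (half_pos hε).le).2 fun i => ?_) (half_lt_self hε)
    have h1 : ‖∫ s in U, (g i j s - g i j t) ∂ν‖ ≤ ε / 2 * ν.real U :=
      norm_setIntegral_le_of_norm_le_const (by finiteness) fun s hs => (hU s hs i).le
    have h2 : ∫ s in U, (g i j s - g i j t) ∂ν = (∫ s in U, g i j s ∂ν) - ν.real U * g i j t := by
      rw [integral_sub (aux_cont_int g hg _ _ _) (integrable_const _)]
      simp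
    have h3 : auxL g hg ν u i - σ * g i j t =
        σ * ((ν.real U)⁻¹ * ∫ s in U, (g i j s - g i j t) ∂ν) := by
      rw [e, h2]; field_simp
    rw [dist_comm, Real.dist_eq, h3, abs_mul, hσ, one_mul, abs_mul, abs_of_pos (inv_pos.2 hpos),
      inv_mul_le_iff₀ hpos, mul_comm]
    exact h1

lemma aux_subset (g : Fin n → Fin m → X → ℝ) (hg : ∀ i j, Continuous (g i j))
    (ν : Measure X) [IsFiniteMeasure ν] [ν.IsOpenPosMeasure] :
    auxC g ⊆ closure (auxL g hg ν '' (auxN m ν).closedBall 0 1) := by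
  refine convexHull_min ?_ (((auxN m ν).convex_closedBall 0 1).linear_image _).closure
  rintro x (rfl | hx)
  · refine subset_closure ⟨0, ?_, map_zero _⟩
    rw [Seminorm.mem_closedBall_zero, map_zero]
    exact zero_le_one
  · obtain ⟨j, ⟨t, rfl⟩ | ⟨t, rfl⟩⟩ := Set.mem_iUnion.1 hx
    · simpa using aux_point g hg ν 1 (by simp) j t
    · simpa using aux_point g hg ν (-1) (by simp) j t

open scoped Pointwise in
lemma aux_final (ν : Measure X) [IsFiniteMeasure ν] [ν.IsOpenPosMeasure]
    (g : Fin n → Fin m → X → ℝ) (hg : ∀ i j, Continuous (g i j))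
    (h : Fin n → ℝ)
    (u0 : Fin m → X → ℝ) (hu0int : ∀ j, Integrable (u0 j) ν)
    (hu0con : ∀ i, ∑ j, ∫ t, g i j t * u0 j t ∂ν = h i) :
    ∃ r0, IsLeast {r : ℝ | ∃ μ : Fin m → SignedMeasure X,
          (∀ i, bra (g i) μ = h i) ∧ r = tvn μ} r0 ∧
      IsGLB {r : ℝ | ∃ u : Fin m → X → ℝ, (∀ j, Integrable (u j) ν) ∧
        (∀ i, ∑ j, ∫ t, g i j t * u j t ∂ν = h i) ∧ r = ∑ j, ∫ t, |u j t| ∂ν} r0 := by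
  have L1pos : ∀ u : Fin m → X → ℝ, 0 ≤ ∑ j, ∫ t, |u j t| ∂ν := fun u =>
    Finset.sum_nonneg fun j _ => integral_nonneg fun t => abs_nonneg _
  have PL : ∀ u : Fin m → X → ℝ, (∀ j, Integrable (u j) ν) →
      (∀ i, ∑ j, ∫ t, g i j t * u j t ∂ν = h i) → h ∈ (∑ j, ∫ t, |u j t| ∂ν) • auxC g := by
    intro u hu hc
    have := aux_L1_mem g hg ν u hu
    rwa [funext hc] at this
  set R := ∑ j, ∫ t, |u0 j t| ∂ν with hR
  have hRmem : h ∈ R • auxC g := PL u0 hu0int hu0con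
  have hR0 : 0 ≤ R := L1pos u0
  let K : Set (ℝ × (Fin n → ℝ)) := (Set.Icc 0 R ×ˢ auxC g) ∩ {x | x.1 • x.2 = h}
  have hK : IsCompact K := (isCompact_Icc.prod (auxC_compact g hg)).inter_right
    (isClosed_eq (by fun_prop) continuous_const)
  have hKne : (Prod.fst '' K).Nonempty := by
    obtain ⟨c, hc, hch⟩ := hRmem
    exact ⟨R, (R, c), ⟨⟨⟨hR0, le_rfl⟩, hc⟩, hch⟩, rfl⟩
  obtain ⟨r0, ⟨⟨_, c⟩, ⟨⟨⟨h0, hle⟩, hc⟩, hch⟩, rfl⟩, hmin⟩ :=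
    (hK.image continuous_fst).exists_isLeast hKne
  rename_i r0
  simp only at h0 hle hc hch
  have hr0 : h ∈ r0 • auxC g := ⟨c, hc, hch⟩
  have lb : ∀ r, 0 ≤ r → h ∈ r • auxC g → r0 ≤ r := by
    intro r hr ⟨d, hd, hdh⟩
    rcases le_total r R with hrR | hrR
    · exact hmin ⟨(r, d), ⟨⟨⟨hr, hrR⟩, hd⟩, hdh⟩, rfl⟩
    · exact hle.trans hrR
  have lbM : ∀ μ : Fin m → SignedMeasure X, (∀ i, bra (g i) μ = h i) → r0 ≤ tvn μ := by
    intro μ hμ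
    have := aux_signed_mem g hg μ
    rw [funext hμ] at this
    exact lb _ (Finset.sum_nonneg fun j _ => ENNReal.toReal_nonneg) this
  refine ⟨r0, ⟨?_, ?_⟩, ?_, ?_⟩
  · obtain ⟨μ, hμ, hle⟩ := aux_exists_signed g hg h r0 h0 hr0
    exact ⟨μ, hμ, le_antisymm (lbM μ hμ) hle⟩
  · rintro _ ⟨μ, hμ, rfl⟩
    exact lbM μ hμ
  · rintro _ ⟨u, hu, hc, rfl⟩
    exact lb _ (L1pos u) (PL u hu hc)
  · intro x hx
    refine le_of_forall_pos_le_add fun ε hε => ?_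
    obtain ⟨u, hu, hN⟩ := aux_abstract (auxN m ν) (auxL g hg ν) h
      ⟨⟨u0, hu0int⟩, funext hu0con⟩ r0 h0 (Set.smul_set_mono (aux_subset g hg ν) hr0) ε hε
    exact (hx ⟨u.1, u.2, fun i => congrFun hu i, rfl⟩).trans hN

end

lemma aux_openPos {a b : ℝ} (hab : a < b) :
    (volume : Measure (Set.Icc a b)).IsOpenPosMeasure := by
  refine ⟨fun U hU hne => ?_⟩
  obtain ⟨t, ht⟩ := hne
  obtain ⟨δ, hδ, hball⟩ := Metric.isOpen_iff.1 hU t ht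
  rw [← volume_image_subtype_coe measurableSet_Icc]
  have hsub : Set.Ioo (max a (t - δ)) (min b (t + δ)) ⊆ ((↑) '' U : Set ℝ) := by
    intro s hs
    simp only [Set.mem_Ioo, max_lt_iff, lt_min_iff] at hs
    refine ⟨⟨s, hs.1.1.le, hs.2.1.le⟩, hball ?_, rfl⟩
    rw [Metric.mem_ball, Subtype.dist_eq, Real.dist_eq, abs_lt]
    constructor <;> simp only <;> linarith [hs.1.2, hs.2.2]
  intro h0
  have := measure_mono_null hsub h0
  rw [Real.volume_Ioo, ENNReal.ofReal_eq_zero] at this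
  have h1 : max a (t - δ) < min b (t + δ) := by
    have := t.2.1
    have := t.2.2
    rw [max_lt_iff, lt_min_iff, lt_min_iff]
    refine ⟨⟨hab, ?_⟩, ?_, ?_⟩ <;> linarith
  linarith

/-- If some `u ∈ L¹([a,b]; ℝ^m)` satisfies the linear constraints, then the
relaxed moment problem attains its infimum `p*` at some vector measure `μ*`, and
`p*` equals the infimum `q*` of the L¹ problem. -/
theorem stmt0 {m n : ℕ} {a b : ℝ} (hab : a < b)
    (g : Fin n → Fin m → Set.Icc a b → ℝ) (hg : ∀ i j, Continuous (g i j))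
    (h : Fin n → ℝ)
    (u0 : Fin m → Set.Icc a b → ℝ) (hu0int : ∀ j, Integrable (u0 j))
    (hu0con : ∀ i, ∑ j, ∫ t, g i j t * u0 j t = h i) :
    (∃ μstar : Fin m → SignedMeasure (Set.Icc a b),
        (∀ i, bra (g i) μstar = h i) ∧
        tvn μstar = sInf {r : ℝ | ∃ μ : Fin m → SignedMeasure (Set.Icc a b),
          (∀ i, bra (g i) μ = h i) ∧ r = tvn μ}) ∧
    sInf {r : ℝ | ∃ μ : Fin m → SignedMeasure (Set.Icc a b),
        (∀ i, bra (g i) μ = h i) ∧ r = tvn μ} =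
    sInf {r : ℝ | ∃ u : Fin m → Set.Icc a b → ℝ, (∀ j, Integrable (u j)) ∧
        (∀ i, ∑ j, ∫ t, g i j t * u j t = h i) ∧ r = ∑ j, ∫ t, |u j t|} := by
  have : (volume : Measure (Set.Icc a b)).IsOpenPosMeasure := aux_openPos hab
  have : IsFiniteMeasure (volume : Measure (Set.Icc a b)) := by
    refine ⟨?_⟩
    rw [Measure.Subtype.volume_univ measurableSet_Icc.nullMeasurableSet, Real.volume_Icc]
    exact ENNReal.ofReal_lt_top
  obtain ⟨r0, h1, h2⟩ := aux_final volume g hg h u0 hu0int hu0con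
  have hne : {r : ℝ | ∃ u : Fin m → Set.Icc a b → ℝ, (∀ j, Integrable (u j)) ∧
        (∀ i, ∑ j, ∫ t, g i j t * u j t = h i) ∧ r = ∑ j, ∫ t, |u j t|}.Nonempty :=
    ⟨_, u0, hu0int, hu0con, rfl⟩
  rw [h2.csInf_eq hne, h1.csInf_eq]
  obtain ⟨μ, hμ, hr⟩ := h1.1
  exact ⟨⟨μ, hμ, hr.symm⟩, rfl⟩
end

section
/- If the moment problem is feasible (there exists μ ∈ M([a,b]; ℝ^m) with ⟨g_i, μ⟩ = h_i for all i = 1,…,n), then there exists an optimal solution μ* (i.e., feasible with ‖μ*‖_TV = p*, where p* is the infimum of ‖μ‖_TV over feasible μ) that is a signed sum of at most n Dirac measures: there exist N ≤ n, times t_1,…,t_N ∈ [a,b], indices j_1,…,j_N ∈ {1,…,m}, and nonzero reals c_1,…,c_N such that the j-th component of μ* equals Σ_{k : j_k = j} c_k δ_{t_k} for each j = 1,…,m. -/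
open MeasureTheory

attribute [local instance] MeasureTheory.Measure.Subtype.measureSpace

lemma aux_meas {X : Type*} [MeasurableSpace X] (μ : SignedMeasure X) (ρ ν : Measure X)
    [IsFiniteMeasure ρ] [IsFiniteMeasure ν]
    (hμ : μ = ρ.toSignedMeasure - ν.toSignedMeasure) :
    μ.toJordanDecomposition.posPart + ν = μ.toJordanDecomposition.negPart + ρ := by
  rw [← Measure.toSignedMeasure_eq_toSignedMeasure_iff, Measure.toSignedMeasure_add,
    Measure.toSignedMeasure_add]
  have h1 := μ.toSignedMeasure_toJordanDecomposition
  rw [JordanDecomposition.toSignedMeasure] at h1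
  rw [hμ] at h1 ⊢
  rw [sub_eq_sub_iff_add_eq_add] at h1
  rw [h1, add_comm]

lemma aux_int {X : Type*} [MeasurableSpace X] (μ : SignedMeasure X) (ρ ν : Measure X)
    [IsFiniteMeasure ρ] [IsFiniteMeasure ν]
    (hμ : μ = ρ.toSignedMeasure - ν.toSignedMeasure) (f : X → ℝ)
    (hf : ∀ κ : Measure X, IsFiniteMeasure κ → Integrable f κ) :
    sigInt f μ = ∫ t, f t ∂ρ - ∫ t, f t ∂ν := by
  have h := congrArg (fun κ : Measure X => ∫ t, f t ∂κ) (aux_meas μ ρ ν hμ)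
  beta_reduce at h
  rw [integral_add_measure (hf _ inferInstance) (hf _ inferInstance),
    integral_add_measure (hf _ inferInstance) (hf _ inferInstance)] at h
  unfold sigInt
  linarith

lemma aux_tv_eq {X : Type*} [MeasurableSpace X] (μ : SignedMeasure X) :
    (μ.totalVariation Set.univ).toReal = μ.toJordanDecomposition.posPart.real Set.univ +
      μ.toJordanDecomposition.negPart.real Set.univ := by
  rw [SignedMeasure.totalVariation, Measure.add_apply, ENNReal.toReal_add (by finiteness)
    (by finiteness)]
  rfl

lemma aux_tv {X : Type*} [MeasurableSpace X] (μ : SignedMeasure X) (ρ ν : Measure X)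
    [IsFiniteMeasure ρ] [IsFiniteMeasure ν]
    (hμ : μ = ρ.toSignedMeasure - ν.toSignedMeasure) :
    (μ.totalVariation Set.univ).toReal ≤ ρ.real Set.univ + ν.real Set.univ := by
  rw [aux_tv_eq]
  obtain ⟨i, hi₁, hi₂, hi₃, hp, hn⟩ := μ.toJordanDecomposition_spec
  rw [hp, hn, SignedMeasure.toMeasureOfZeroLE_real_apply _ hi₂ hi₁ MeasurableSet.univ,
    SignedMeasure.toMeasureOfLEZero_real_apply _ hi₃ hi₁.compl MeasurableSet.univ,
    Set.inter_univ, Set.inter_univ, hμ, Measure.toSignedMeasure_sub_apply hi₁,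
    Measure.toSignedMeasure_sub_apply hi₁.compl]
  have h1 : ρ.real i ≤ ρ.real Set.univ := measureReal_mono (Set.subset_univ _)
  have h2 : ν.real iᶜ ≤ ν.real Set.univ := measureReal_mono (Set.subset_univ _)
  have h3 : 0 ≤ ν.real i := measureReal_nonneg
  have h4 : 0 ≤ ρ.real iᶜ := measureReal_nonneg
  linarith

lemma aux_bound {X : Type*} [MeasurableSpace X] (μ : SignedMeasure X) (f : X → ℝ) (M : ℝ)
    (hM : ∀ x, |f x| ≤ M) :
    sigInt f μ ≤ M * (μ.totalVariation Set.univ).toReal := by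
  rw [aux_tv_eq]
  have h1 := norm_integral_le_of_norm_le_const (μ := μ.toJordanDecomposition.posPart) (f := f)
    (Filter.Eventually.of_forall hM)
  have h2 := norm_integral_le_of_norm_le_const (μ := μ.toJordanDecomposition.negPart) (f := f)
    (Filter.Eventually.of_forall hM)
  rw [Real.norm_eq_abs, abs_le] at h1 h2
  unfold sigInt
  linarith [h1.2, h2.1]

lemma aux_dirac {X ι : Type*} [MeasurableSpace X] [MeasurableSingletonClass X]
    (s : Finset ι) (c : ι → ℝ) (t : ι → X) :
    ∃ (ρ ν : Measure X) (_ : IsFiniteMeasure ρ) (_ : IsFiniteMeasure ν),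
      ∑ k ∈ s, c k • (Measure.dirac (t k)).toSignedMeasure
        = ρ.toSignedMeasure - ν.toSignedMeasure ∧
      (∀ f : X → ℝ, (∀ κ : Measure X, IsFiniteMeasure κ → Integrable f κ) →
        ∫ x, f x ∂ρ - ∫ x, f x ∂ν = ∑ k ∈ s, c k * f (t k)) ∧
      ρ.real Set.univ + ν.real Set.univ = ∑ k ∈ s, |c k| := by
  classical
  induction s using Finset.induction_on with
  | empty => exact ⟨0, 0, inferInstance, inferInstance, by simp, by simp, by simp⟩
  | insert a s ha ih =>
    obtain ⟨ρ, ν, h1, h2, h3, h4, h5⟩ := ih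
    rcases le_total 0 (c a) with hc | hc
    · lift c a to NNReal using hc with r hr
      refine ⟨ρ + r • Measure.dirac (t a), ν, inferInstance, inferInstance, ?_, ?_, ?_⟩
      · rw [Finset.sum_insert ha, h3, Measure.toSignedMeasure_add, Measure.toSignedMeasure_smul,
          ← hr]
        ext i hi
        simp [NNReal.smul_def, hi]
        ring
      · intro f hf
        rw [Finset.sum_insert ha, ← h4 f hf, integral_add_measure (hf _ inferInstance)
          (hf _ inferInstance), integral_smul_nnreal_measure, integral_dirac, ← hr]
        simp only [NNReal.smul_def, smul_eq_mul]
        ring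
      · rw [Finset.sum_insert ha, ← h5, ← hr, measureReal_add_apply,
          measureReal_nnreal_smul_apply]
        simp
        ring
    · have hc' : 0 ≤ - c a := by linarith
      obtain ⟨r, hr⟩ : ∃ r : NNReal, (r : ℝ) = - c a := ⟨⟨_, hc'⟩, rfl⟩
      have hr' : c a = - (r : ℝ) := by linarith
      refine ⟨ρ, ν + r • Measure.dirac (t a), inferInstance, inferInstance, ?_, ?_, ?_⟩
      · rw [Finset.sum_insert ha, h3, Measure.toSignedMeasure_add, Measure.toSignedMeasure_smul,
          hr']
        ext i hi
        simp [NNReal.smul_def, hi]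
        ring
      · intro f hf
        rw [Finset.sum_insert ha, ← h4 f hf, integral_add_measure (hf _ inferInstance)
          (hf _ inferInstance), integral_smul_nnreal_measure, integral_dirac, hr']
        simp only [NNReal.smul_def, smul_eq_mul]
        ring
      · rw [Finset.sum_insert ha, ← h5, hr', measureReal_add_apply,
          measureReal_nnreal_smul_apply]
        simp
        ring

lemma aux_cara {E : Type*} [AddCommGroup E] [Module ℝ E] (p : ℕ) :
    ∀ (s : Finset E) (c : E → ℝ), s.card = p → (∀ y ∈ s, 0 ≤ c y) →
    ∃ (t : Finset E) (d : E → ℝ), t ⊆ s ∧ (∀ y ∈ t, 0 ≤ d y) ∧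
      LinearIndepOn ℝ id (t : Set E) ∧
      ∑ y ∈ t, d y • y = ∑ y ∈ s, c y • y ∧ ∑ y ∈ t, d y ≤ ∑ y ∈ s, c y := by
  classical
  induction p using Nat.strong_induction_on with
  | _ p ih =>
  intro s c hs hc
  have key : ∀ e : E → ℝ, (∀ y ∈ s, 0 ≤ e y) → (∃ y ∈ s, e y = 0) →
      ∑ y ∈ s, e y • y = ∑ y ∈ s, c y • y → ∑ y ∈ s, e y ≤ ∑ y ∈ s, c y →
      ∃ (t : Finset E) (d : E → ℝ), t ⊆ s ∧ (∀ y ∈ t, 0 ≤ d y) ∧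
      LinearIndepOn ℝ id (t : Set E) ∧
      ∑ y ∈ t, d y • y = ∑ y ∈ s, c y • y ∧ ∑ y ∈ t, d y ≤ ∑ y ∈ s, c y := by
    rintro e he ⟨z, hz, hz0⟩ h1 h2
    obtain ⟨t, d, ht, hd, hl, h3, h4⟩ := ih (s.erase z).card
      (hs ▸ Finset.card_erase_lt_of_mem hz) (s.erase z) e rfl
      (fun y hy => he y (Finset.mem_of_mem_erase hy))
    refine ⟨t, d, ht.trans (Finset.erase_subset _ _), hd, hl, ?_, ?_⟩
    · rw [h3, ← h1, ← Finset.add_sum_erase s _ hz, hz0]; simp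
    · rw [← Finset.add_sum_erase s e hz, hz0] at h2; linarith
  by_cases hl : LinearIndepOn ℝ id (s : Set E)
  · exact ⟨s, c, subset_rfl, hc, hl, rfl, le_rfl⟩
  rw [linearIndepOn_finset_iff] at hl
  push Not at hl
  obtain ⟨g, hg, i, hi, hgi⟩ := hl
  simp only [id] at hg
  obtain ⟨g, hg, hgs, i, hi, hgi⟩ : ∃ g : E → ℝ, ∑ y ∈ s, g y • y = 0 ∧ 0 ≤ ∑ y ∈ s, g y ∧
      ∃ i ∈ s, g i ≠ 0 := by
    rcases le_total 0 (∑ y ∈ s, g y) with h | h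
    · exact ⟨g, hg, h, i, hi, hgi⟩
    · refine ⟨-g, ?_, ?_, i, hi, ?_⟩
      · simp [hg]
      · simpa using h
      · simpa using hgi
  have hpos : (s.filter (fun y => 0 < g y)).Nonempty := by
    by_contra hne
    rw [Finset.not_nonempty_iff_eq_empty, Finset.filter_eq_empty_iff] at hne
    have h0 : ∑ y ∈ s, g y < 0 := Finset.sum_neg' (fun y hy => not_lt.1 (hne hy))
      ⟨i, hi, lt_of_le_of_ne (not_lt.1 (hne hi)) hgi⟩
    linarith
  obtain ⟨z, hz, hmin⟩ := Finset.exists_min_image _ (fun y => c y / g y) hpos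
  rw [Finset.mem_filter] at hz
  have hq : 0 ≤ c z / g z := div_nonneg (hc z hz.1) hz.2.le
  refine key (fun y => c y - (c z / g z) * g y) ?_ ⟨z, hz.1, ?_⟩ ?_ ?_
  · intro y hy
    rcases lt_or_ge 0 (g y) with h | h
    · have := hmin y (Finset.mem_filter.2 ⟨hy, h⟩)
      rw [le_div_iff₀ h] at this
      simpa using this
    · have := mul_nonneg hq (neg_nonneg.2 h)
      have := hc y hy
      linarith
  · have := hz.2.ne'
    field_simp
    simp
  · simp only [sub_smul, mul_smul, Finset.sum_sub_distrib, ← Finset.smul_sum, hg]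
    simp
  · simp only [Finset.sum_sub_distrib, ← Finset.mul_sum]
    have := mul_nonneg hq hgs
    linarith

/-- Compact set of subconvex combinations of `N` points of `S`. -/
def auxK {E : Type*} [AddCommGroup E] [Module ℝ E] (S : Set E) (N : ℕ) : Set E :=
  (fun p : (Fin N → ℝ) × (Fin N → E) => ∑ k, p.1 k • p.2 k) ''
    ({c | (∀ k, 0 ≤ c k) ∧ ∑ k, c k ≤ 1} ×ˢ Set.univ.pi (fun _ => S))

lemma auxK_compact {E : Type*} [NormedAddCommGroup E] [NormedSpace ℝ E] {S : Set E}
    (hS : IsCompact S) (N : ℕ) : IsCompact (auxK S N) := by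
  unfold auxK
  refine IsCompact.image (IsCompact.prod ?_ (isCompact_univ_pi fun _ => hS)) (by fun_prop)
  refine IsCompact.of_isClosed_subset (isCompact_Icc (a := (0 : Fin N → ℝ)) (b := 1)) ?_ ?_
  · have h1 : IsClosed {c : Fin N → ℝ | ∀ k, 0 ≤ c k} := by
      simp only [Set.ofPred_forall]
      exact isClosed_iInter fun k => isClosed_le (by fun_prop) (by fun_prop)
    have h2 : IsClosed {c : Fin N → ℝ | ∑ k, c k ≤ 1} :=
      isClosed_le (by fun_prop) (by fun_prop)
    exact h1.inter h2
  · rintro c ⟨hc, hc1⟩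
    refine ⟨hc, fun k => ?_⟩
    exact (Finset.single_le_sum (fun i _ => hc i) (Finset.mem_univ k)).trans hc1

lemma auxK_hull {n : ℕ} {S : Set (Fin n → ℝ)} :
    convexHull ℝ S ⊆ ⋃ N ∈ Set.Iic n, auxK S N := by
  intro x hx
  rw [convexHull_eq_union_convexHull_finite_subsets] at hx
  simp only [Set.mem_iUnion] at hx
  obtain ⟨s, hs, hx⟩ := hx
  rw [Finset.mem_convexHull'] at hx
  obtain ⟨w, hw, hw1, hwx⟩ := hx
  obtain ⟨t, d, hts, hd, hl, h1, h2⟩ := aux_cara s.card s w rfl hw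
  have hcard : t.card ≤ n := by
    have := hl.fintype_card_le_finrank
    simpa using this
  simp only [Set.mem_iUnion]
  refine ⟨t.card, hcard, (fun k => d (t.equivFin.symm k), fun k => (t.equivFin.symm k : _)),
    ⟨⟨fun k => hd _ (t.equivFin.symm k).2, ?_⟩, fun k _ => hs (hts (t.equivFin.symm k).2)⟩, ?_⟩
  · rw [Equiv.sum_comp t.equivFin.symm (fun y : t => d y), Finset.sum_coe_sort t d]
    linarith
  · simp only
    rw [Equiv.sum_comp t.equivFin.symm (fun y : t => d y • (y : Fin n → ℝ)),
      Finset.sum_coe_sort t (fun y => d y • y), h1, hwx]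

open scoped Pointwise in
lemma aux_moment {X : Type*} [TopologicalSpace X] [CompactSpace X] [MeasurableSpace X]
    [BorelSpace X] {m n : ℕ} (g : Fin n → Fin m → X → ℝ) (hg : ∀ i j, Continuous (g i j))
    (S : Set (Fin n → ℝ)) (h0 : 0 ∈ S)
    (hS1 : ∀ j t, (fun i => g i j t) ∈ S) (hS2 : ∀ j t, -(fun i => g i j t) ∈ S)
    (hS : IsCompact S)
    (μ : Fin m → SignedMeasure X) :
    ∃ N ≤ n, ∃ k ∈ auxK S N, (fun i => bra (g i) μ) = tvn μ • k := by
  have hint : ∀ f : X → ℝ, Continuous f → ∀ κ : Measure X, IsFiniteMeasure κ →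
      Integrable f κ := fun f hf κ _ =>
    hf.integrable_of_hasCompactSupport (HasCompactSupport.of_compactSpace f)
  have hKc : IsCompact (⋃ N ∈ Set.Iic n, auxK S N) :=
    (Set.finite_Iic n).isCompact_biUnion fun N _ => auxK_compact hS N
  set C := closure (convexHull ℝ S) with hC
  have hCK : C ⊆ ⋃ N ∈ Set.Iic n, auxK S N :=
    closure_minimal auxK_hull hKc.isClosed
  have hCc : IsCompact C := hKc.of_isClosed_subset isClosed_closure hCK
  have hSC : S ⊆ C := (subset_convexHull ℝ S).trans subset_closure
  suffices hmem : (fun i => bra (g i) μ) ∈ tvn μ • C by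
    obtain ⟨k, hk, hk'⟩ := hmem
    have := hCK hk
    simp only [Set.mem_iUnion] at this
    obtain ⟨N, hN, hkN⟩ := this
    exact ⟨N, hN, k, hkN, hk'.symm⟩
  by_contra hnot
  obtain ⟨f, u, hfu, huf⟩ := geometric_hahn_banach_closed_point
    (((convex_convexHull ℝ S).closure).smul (tvn μ)) (hCc.smul (tvn μ)).isClosed hnot
  obtain ⟨k0, hk0, hmax⟩ := hCc.exists_isMaxOn ⟨0, hSC h0⟩ f.continuous.continuousOn
  have hfk := hfu (tvn μ • k0) (Set.smul_mem_smul_set hk0)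
  rw [map_smul, smul_eq_mul] at hfk
  have hfe : ∀ y : Fin n → ℝ, f y = ∑ i, f (Pi.single i 1) * y i := by
    intro y
    conv_lhs => rw [pi_eq_sum_univ' y]
    rw [map_sum]
    refine Finset.sum_congr rfl fun i _ => ?_
    rw [map_smul, smul_eq_mul, mul_comm]
  have hb : f (fun i => bra (g i) μ) = ∑ j, sigInt (fun t => f (fun i => g i j t)) (μ j) := by
    rw [hfe]
    simp only [bra, Finset.mul_sum]
    rw [Finset.sum_comm]
    refine Finset.sum_congr rfl fun j _ => ?_
    simp only [sigInt, hfe (fun i => g i j _)]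
    rw [integral_finsetSum _ fun i _ => (hint _ (hg i j) _ inferInstance).const_mul _,
      integral_finsetSum _ fun i _ => (hint _ (hg i j) _ inferInstance).const_mul _,
      ← Finset.sum_sub_distrib]
    refine Finset.sum_congr rfl fun i _ => ?_
    rw [integral_const_mul, integral_const_mul, mul_sub]
  have hle : f (fun i => bra (g i) μ) ≤ tvn μ * f k0 := by
    rw [hb, tvn, mul_comm, Finset.mul_sum]
    refine Finset.sum_le_sum fun j _ => aux_bound _ _ _ fun t => ?_
    rw [abs_le']
    refine ⟨hmax (hSC (hS1 j t)), ?_⟩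
    rw [← map_neg]
    exact hmax (hSC (hS2 j t))
  linarith

/-- If the moment problem is feasible, there is an optimal solution which is
a signed sum of at most `n` Dirac measures. -/
theorem stmt2 {m n : ℕ} {a b : ℝ} (hab : a < b)
    (g : Fin n → Fin m → Set.Icc a b → ℝ) (hg : ∀ i j, Continuous (g i j))
    (h : Fin n → ℝ)
    (hfeas : ∃ μ : Fin m → SignedMeasure (Set.Icc a b), ∀ i, bra (g i) μ = h i) :
    ∃ (N : ℕ) (_ : N ≤ n) (tk : Fin N → Set.Icc a b) (jk : Fin N → Fin m) (c : Fin N → ℝ)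
      (μstar : Fin m → SignedMeasure (Set.Icc a b)),
      (∀ k, c k ≠ 0) ∧
      (∀ j, μstar j =
        ∑ k ∈ Finset.univ.filter (fun k => jk k = j),
          c k • (MeasureTheory.Measure.dirac (tk k)).toSignedMeasure) ∧
      (∀ i, bra (g i) μstar = h i) ∧
      tvn μstar = sInf {r : ℝ | ∃ μ : Fin m → SignedMeasure (Set.Icc a b),
        (∀ i, bra (g i) μ = h i) ∧ r = tvn μ} := by
  classical
  set F : Fin m × Set.Icc a b → (Fin n → ℝ) := fun p i => g i p.1 p.2 with hF
  have hFc : Continuous F := by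
    refine continuous_pi fun i => ?_
    exact continuous_prod_of_discrete_left.2 fun j => hg i j
  set S : Set (Fin n → ℝ) := insert 0 (Set.range F ∪ Set.range (-F)) with hSdef
  have hS : IsCompact S :=
    ((isCompact_range hFc).union (isCompact_range hFc.neg)).insert 0
  have hint : ∀ f : Set.Icc a b → ℝ, Continuous f → ∀ κ : Measure (Set.Icc a b),
      IsFiniteMeasure κ → Integrable f κ := fun f hf κ _ =>
    hf.integrable_of_hasCompactSupport (HasCompactSupport.of_compactSpace f)
  have hmom := aux_moment g hg S (Set.mem_insert _ _)
    (fun j t => Or.inr (Or.inl ⟨(j, t), rfl⟩)) (fun j t => Or.inr (Or.inr ⟨(j, t), rfl⟩)) hS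
  have htv : ∀ μ : Fin m → SignedMeasure (Set.Icc a b), 0 ≤ tvn μ := fun μ =>
    Finset.sum_nonneg fun j _ => ENNReal.toReal_nonneg
  obtain ⟨μ0, hμ0⟩ := hfeas
  set K := ⋃ N ∈ Set.Iic n, auxK S N with hK
  have hKc : IsCompact K :=
    (Set.finite_Iic n).isCompact_biUnion fun N _ => auxK_compact hS N
  have hmom' : ∀ μ : Fin m → SignedMeasure (Set.Icc a b), (∀ i, bra (g i) μ = h i) →
      ∃ k ∈ K, tvn μ • k = h := by
    intro μ hμ
    obtain ⟨N, hN, k, hk, hkk⟩ := hmom μ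
    refine ⟨k, ?_, ?_⟩
    · simp only [hK, Set.mem_iUnion]
      exact ⟨N, hN, hk⟩
    · rw [← hkk]; funext i; exact hμ i
  have hTc : IsCompact ((Set.Icc 0 (tvn μ0) ×ˢ K) ∩
      {p : ℝ × (Fin n → ℝ) | p.1 • p.2 = h}) :=
    (isCompact_Icc.prod hKc).inter_right (isClosed_eq (by fun_prop) (by fun_prop))
  obtain ⟨k0, hk0, hk0'⟩ := hmom' μ0 hμ0
  obtain ⟨⟨r, k⟩, ⟨⟨hr, hk⟩, hrk⟩, hmin⟩ := hTc.exists_isMinOn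
    ⟨(tvn μ0, k0), ⟨⟨htv μ0, le_rfl⟩, hk0⟩, hk0'⟩ (continuous_fst.continuousOn)
  simp only [Set.mem_ofPred_eq] at hrk hr hk
  have hlow : ∀ μ : Fin m → SignedMeasure (Set.Icc a b), (∀ i, bra (g i) μ = h i) →
      r ≤ tvn μ := by
    intro μ hμ
    obtain ⟨k', hk', hkk'⟩ := hmom' μ hμ
    rcases le_total (tvn μ) (tvn μ0) with hle | hle
    · exact hmin (a := (tvn μ, k')) ⟨⟨⟨htv μ, hle⟩, hk'⟩, hkk'⟩
    · exact hr.2.trans hle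
  simp only [hK, Set.mem_iUnion] at hk
  obtain ⟨N, hN, ⟨c, v⟩, ⟨⟨hc0, hc1⟩, hv⟩, hcv⟩ := hk
  simp only at hcv hc0 hc1 hv
  set A : Finset (Fin N) := Finset.univ.filter (fun k => r * c k ≠ 0 ∧ v k ≠ 0) with hA
  have hAcard : A.card ≤ n :=
    (Finset.card_le_univ A).trans (by simpa using hN)
  have hrep : ∀ k : A, ∃ (p : Fin m × Set.Icc a b) (e : ℝ), |e| = 1 ∧ v k = e • F p := by
    intro k
    rcases hv k (Set.mem_univ _) with h1 | ⟨p, hp⟩ | ⟨p, hp⟩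
    · exact absurd h1 (Finset.mem_filter.1 k.2).2.2
    · exact ⟨p, 1, by simp, by simp [hp]⟩
    · exact ⟨p, -1, by simp, by simp [← hp]⟩
  choose p e he hve using hrep
  set E := A.equivFin with hE
  have hA0 : ∀ k : A, r * c k ≠ 0 := fun k => (Finset.mem_filter.1 k.2).2.1
  let C : Fin A.card → ℝ := fun k => r * c (E.symm k) * e (E.symm k)
  let T : Fin A.card → Set.Icc a b := fun k => (p (E.symm k)).2
  let J : Fin A.card → Fin m := fun k => (p (E.symm k)).1
  let μs : Fin m → SignedMeasure (Set.Icc a b) := fun j =>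
    ∑ k ∈ Finset.univ.filter (fun k => J k = j), C k • (Measure.dirac (T k)).toSignedMeasure
  have hbra : ∀ i, bra (g i) μs = h i := by
    intro i
    have h1 : ∀ j, sigInt (g i j) (μs j) =
        ∑ k ∈ Finset.univ.filter (fun k => J k = j), C k * g i (J k) (T k) := by
      intro j
      obtain ⟨ρ, ν, i1, i2, h3, h4, h5⟩ := aux_dirac
        (Finset.univ.filter (fun k => J k = j)) C T
      rw [aux_int (μs j) ρ ν h3 (g i j) (hint _ (hg i j)), h4 _ (hint _ (hg i j))]
      refine Finset.sum_congr rfl fun k hk => ?_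
      rw [(Finset.mem_filter.1 hk).2]
    unfold bra
    simp only [h1]
    rw [Finset.sum_fiberwise]
    have h2 : ∀ k, C k * g i (J k) (T k) = r * c (E.symm k) * v (E.symm k) i := by
      intro k
      rw [hve]
      simp only [C, J, T, hF, Pi.smul_apply, smul_eq_mul]
      ring
    simp only [h2]
    rw [Equiv.sum_comp E.symm (fun y : A => r * c y * v y i),
      Finset.sum_coe_sort A (fun y => r * c y * v y i), ← hrk, ← hcv]
    simp only [Pi.smul_apply, Finset.sum_apply, smul_eq_mul, Finset.mul_sum]
    rw [hA, Finset.sum_filter]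
    refine Finset.sum_congr rfl fun k _ => ?_
    split_ifs with hh
    · ring
    · rw [not_and_or, not_not, not_not] at hh
      rcases hh with hh | hh
      · rw [← mul_assoc, hh, zero_mul]
      · simp [hh]
  have htvs : tvn μs ≤ r := by
    have h1 : ∀ j, ((μs j).totalVariation Set.univ).toReal ≤
        ∑ k ∈ Finset.univ.filter (fun k => J k = j), |C k| := by
      intro j
      obtain ⟨ρ, ν, i1, i2, h3, h4, h5⟩ := aux_dirac
        (Finset.univ.filter (fun k => J k = j)) C T
      rw [← h5]
      exact aux_tv (μs j) ρ ν h3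
    calc tvn μs ≤ ∑ j, ∑ k ∈ Finset.univ.filter (fun k => J k = j), |C k| :=
          Finset.sum_le_sum fun j _ => h1 j
      _ = ∑ k, |C k| := Finset.sum_fiberwise _ _ _
      _ = ∑ k, r * c (E.symm k) := by
          refine Finset.sum_congr rfl fun k _ => ?_
          simp only [C]
          rw [abs_mul, he, mul_one, abs_of_nonneg (mul_nonneg hr.1 (hc0 _))]
      _ = ∑ k ∈ A, r * c k := by
          rw [Equiv.sum_comp E.symm (fun y : A => r * c y),
            Finset.sum_coe_sort A (fun y => r * c y)]
      _ ≤ ∑ k, r * c k := Finset.sum_le_sum_of_subset_of_nonneg (Finset.subset_univ _)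
          fun k _ _ => mul_nonneg hr.1 (hc0 _)
      _ = r * ∑ k, c k := by rw [Finset.mul_sum]
      _ ≤ r := mul_le_of_le_one_right hr.1 hc1
  refine ⟨A.card, hAcard, T, J, C, μs, ?_, fun j => rfl, hbra, ?_⟩
  · intro k
    refine mul_ne_zero (hA0 _) fun h0 => ?_
    have := he (E.symm k)
    rw [h0] at this
    simp at this
  · symm
    refine IsLeast.csInf_eq ⟨⟨μs, hbra, rfl⟩, ?_⟩
    rintro _ ⟨μ, hμ, rfl⟩
    exact htvs.trans (hlow μ hμ)
end

section
/- Suppose there exists u ∈ L¹([a,b]; ℝ^m) satisfying ∫_a^b g_i(t)·u(t) dt = h_i for all i = 1,…,n. Then for every μ ∈ M([a,b]; ℝ^m) with ⟨g_i, μ⟩ = h_i for all i, and for every ε > 0, there exists u_ε ∈ L¹([a,b]; ℝ^m) satisfying the constraints exactly, ∫_a^b g_i(t)·u_ε(t) dt = h_i for all i, and such that Σ_{j=1}^m ∫_a^b |u_{ε,j}(t)| dt ≤ ‖μ‖_TV + ε. -/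
open MeasureTheory

attribute [local instance] MeasureTheory.Measure.Subtype.measureSpace

section Aux
variable {X : Type*} [TopologicalSpace X] [CompactSpace X] [MeasurableSpace X] [BorelSpace X]

lemma aux_bdd (g : X → ℝ) (hg : Continuous g) : ∃ C, 0 ≤ C ∧ ∀ t, |g t| ≤ C := by
  obtain ⟨C, hC⟩ := isCompact_univ.exists_bound_of_continuousOn hg.continuousOn
  exact ⟨max C 0, le_max_right _ _, fun t => (hC t trivial).trans (le_max_left _ _)⟩

lemma aux_int_s3 (ν : Measure X) (g : X → ℝ) (hg : Continuous g) (u : X → ℝ) (hu : Integrable u ν) :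
    Integrable (fun t => g t * u t) ν := by
  obtain ⟨C, -, hC⟩ := aux_bdd g hg
  exact hu.bdd_mul hg.measurable.aestronglyMeasurable (Filter.Eventually.of_forall hC)

lemma aux_clm (ν : Measure X) (g : X → ℝ) (hg : Continuous g) :
    ∃ L : Lp ℝ 1 ν →L[ℝ] ℝ, ∀ u : Lp ℝ 1 ν, L u = ∫ t, g t * u t ∂ν := by
  obtain ⟨C, hC0, hC⟩ := aux_bdd g hg
  have hi : ∀ u : Lp ℝ 1 ν, Integrable (fun t => g t * u t) ν :=
    fun u => aux_int_s3 ν g hg u (L1.integrable_coeFn u)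
  let L : Lp ℝ 1 ν →ₗ[ℝ] ℝ :=
    { toFun := fun u => ∫ t, g t * u t ∂ν
      map_add' := by
        intro u v
        rw [← integral_add (hi u) (hi v)]
        apply integral_congr_ae
        filter_upwards [Lp.coeFn_add u v] with t ht
        rw [ht, Pi.add_apply, mul_add]
      map_smul' := by
        intro c u
        simp only [RingHom.id_apply, smul_eq_mul]
        rw [← integral_const_mul]
        apply integral_congr_ae
        filter_upwards [Lp.coeFn_smul c u] with t ht
        rw [ht, Pi.smul_apply, smul_eq_mul]; ring }
  refine ⟨L.mkContinuous C ?_, fun u => rfl⟩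
  intro u
  change ‖∫ t, g t * u t ∂ν‖ ≤ C * ‖u‖
  rw [L1.norm_eq_integral_norm, ← integral_const_mul]
  refine (norm_integral_le_integral_norm _).trans ?_
  refine integral_mono (hi u).norm ((L1.integrable_coeFn u).norm.const_mul C) ?_
  intro t
  simp only [norm_mul]
  exact mul_le_mul_of_nonneg_right (hC t) (norm_nonneg _)

lemma aux_sig (g : X → ℝ) (K : ℝ) (hK : ∀ t, |g t| ≤ K) (μ : SignedMeasure X) :
    sigInt g μ ≤ K * (μ.totalVariation Set.univ).toReal := by
  unfold sigInt SignedMeasure.totalVariation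
  have h1 := norm_integral_le_of_norm_le_const (f := g) (C := K) (μ := μ.toJordanDecomposition.posPart)
    (Filter.Eventually.of_forall hK)
  have h2 := norm_integral_le_of_norm_le_const (f := g) (C := K) (μ := μ.toJordanDecomposition.negPart)
    (Filter.Eventually.of_forall hK)
  rw [Measure.add_apply, ENNReal.toReal_add (measure_ne_top _ _) (measure_ne_top _ _)]
  have h3 := (abs_le.1 h1).2
  have h4 := (abs_le.1 h2).1
  simp only [Measure.real] at h3 h4
  linarith

lemma aux_sig_sum {n : ℕ} (g : Fin n → X → ℝ) (hg : ∀ i, Continuous (g i)) (l : Fin n → ℝ)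
    (μ : SignedMeasure X) :
    sigInt (fun t => ∑ i, l i * g i t) μ = ∑ i, l i * sigInt (g i) μ := by
  have hi : ∀ (ν : Measure X) [IsFiniteMeasure ν] (i : Fin n), Integrable (fun t => l i * g i t) ν := by
    intro ν _ i
    have := aux_int_s3 ν (g i) (hg i) (fun _ => l i) (integrable_const _)
    simpa only [mul_comm] using this
  unfold sigInt
  rw [integral_finsetSum _ (fun i _ => hi _ i), integral_finsetSum _ (fun i _ => hi _ i),
    ← Finset.sum_sub_distrib]
  refine Finset.sum_congr rfl fun i _ => ?_
  rw [integral_const_mul, integral_const_mul, mul_sub]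

lemma aux_bump (ν : Measure X) [IsFiniteMeasure ν] [ν.IsOpenPosMeasure] (G : X → ℝ)
    (hG : Continuous G) (r H : ℝ) (hr : 0 < r) (hH : 0 < H)
    (hu : ∀ u : Lp ℝ 1 ν, ‖u‖ < r → ∫ t, G t * u t ∂ν < H) (t0 : X) : r * G t0 ≤ H := by
  by_contra! hc
  have hG0 : 0 < G t0 := by
    by_contra! h0
    nlinarith
  obtain ⟨s, hs1, hs2⟩ := exists_between ((div_lt_iff₀ hG0).2 hc)
  have hs0 : 0 < s := (div_pos hH hG0).trans hs1
  rw [div_lt_iff₀ hG0] at hs1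
  set U : Set X := {t | H < s * G t} with hU
  have hUo : IsOpen U := isOpen_lt continuous_const (continuous_const.mul hG)
  have hUm := hUo.measurableSet
  have hUpos : 0 < ν.real U :=
    ENNReal.toReal_pos (hUo.measure_pos ν ⟨t0, hs1⟩).ne' (measure_ne_top _ _)
  set u : Lp ℝ 1 ν := indicatorConstLp 1 hUm (measure_ne_top ν U) (s / ν.real U) with hudef
  have hn : ‖u‖ < r := by
    rw [hudef, norm_indicatorConstLp one_ne_zero ENNReal.one_ne_top]
    simp only [ENNReal.toReal_one, div_one, Real.rpow_one, Real.norm_eq_abs]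
    rw [abs_of_pos (div_pos hs0 hUpos), div_mul_cancel₀ _ hUpos.ne']
    exact hs2
  have h1 := hu u hn
  have h2 : ∫ t, G t * u t ∂ν = ∫ t in U, G t * (s / ν.real U) ∂ν := by
    rw [← integral_indicator hUm]
    apply integral_congr_ae
    filter_upwards [indicatorConstLp_coeFn (p := 1) (hs := hUm) (hμs := measure_ne_top ν U)
      (c := s / ν.real U)] with t ht
    rw [hudef, ht]
    by_cases h : t ∈ U <;> simp [h]
  have h3 : ∫ t in U, H / ν.real U ∂ν ≤ ∫ t in U, G t * (s / ν.real U) ∂ν := by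
    refine setIntegral_mono_on (integrable_const _)
      (aux_int_s3 _ G hG (fun _ => s / ν.real U) (integrable_const _)) hUm ?_
    intro t ht
    rw [← mul_div_assoc]
    apply div_le_div_of_nonneg_right _ hUpos.le
    have : H < s * G t := ht
    linarith
  rw [setIntegral_const, smul_eq_mul, mul_div_cancel₀ _ hUpos.ne'] at h3
  linarith

lemma aux_main (ν : Measure X) [IsFiniteMeasure ν] [ν.IsOpenPosMeasure] {m n : ℕ}
    (g : Fin n → Fin m → X → ℝ) (hg : ∀ i j, Continuous (g i j))
    (h : Fin n → ℝ)
    (u0 : Fin m → X → ℝ) (hu0int : ∀ j, Integrable (u0 j) ν)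
    (hu0con : ∀ i, ∑ j, ∫ t, g i j t * u0 j t ∂ν = h i)
    (μ : Fin m → SignedMeasure X) (hμ : ∀ i, bra (g i) μ = h i) (r : ℝ) (hr : tvn μ < r) :
    ∃ u : Fin m → Lp ℝ 1 ν, (∀ i, ∑ j, ∫ t, g i j t * u j t ∂ν = h i) ∧ ∑ j, ‖u j‖ < r := by
  have htv : 0 ≤ tvn μ := Finset.sum_nonneg fun j _ => ENNReal.toReal_nonneg
  have hr0 : 0 < r := htv.trans_lt hr
  choose L hL using fun i j => aux_clm ν (g i j) (hg i j)
  let T : (Fin m → Lp ℝ 1 ν) →L[ℝ] (Fin n → ℝ) :=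
    ContinuousLinearMap.pi fun i => ∑ j, (L i j).comp (ContinuousLinearMap.proj j)
  have hT : ∀ u i, T u i = ∑ j, ∫ t, g i j t * u j t ∂ν := by
    intro u i
    simp [T, hL]
  let V := LinearMap.range T.toLinearMap
  let S : (Fin m → Lp ℝ 1 ν) →L[ℝ] V := T.codRestrict V (fun u => ⟨u, rfl⟩)
  have hS : Function.Surjective S := by
    rintro ⟨_, u, rfl⟩
    exact ⟨u, rfl⟩
  have hSo : IsOpenMap S := S.isOpenMap hS
  let B : Set (Fin m → Lp ℝ 1 ν) := {u | ∑ j, ‖u j‖ < r}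
  have hBo : IsOpen B := isOpen_lt (by fun_prop) continuous_const
  have hBc : Convex ℝ B := by
    have : ConvexOn ℝ Set.univ (fun u : Fin m → Lp ℝ 1 ν => ∑ j, ‖u j‖) := by
      refine ⟨convex_univ, ?_⟩
      intro x _ y _ p q hp hq hpq
      simp only [smul_eq_mul, Finset.mul_sum, ← Finset.sum_add_distrib]
      refine Finset.sum_le_sum fun j _ => ?_
      refine (norm_add_le _ _).trans ?_
      simp [norm_smul, abs_of_nonneg hp, abs_of_nonneg hq]
    simpa [B] using this.convex_lt r
  have hh : h ∈ V := by
    refine ⟨fun j => (hu0int j).toL1 (u0 j), ?_⟩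
    ext i
    rw [← hu0con i]
    refine (hT _ i).trans (Finset.sum_congr rfl fun j _ => integral_congr_ae ?_)
    filter_upwards [(hu0int j).coeFn_toL1] with t ht
    rw [ht]
  by_cases hmem : (⟨h, hh⟩ : V) ∈ S '' B
  · obtain ⟨u, hu, hus⟩ := hmem
    refine ⟨u, fun i => ?_, hu⟩
    rw [← hT]
    exact congrFun (congrArg Subtype.val hus) i
  exfalso
  obtain ⟨f, hf⟩ := geometric_hahn_banach_open_point (hBc.linear_image S.toLinearMap) (hSo _ hBo) hmem
  obtain ⟨F, hF⟩ := LinearMap.exists_extend (f : V →ₗ[ℝ] ℝ)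
  have hF' : ∀ v : V, f v = F v := fun v => (LinearMap.congr_fun hF v).symm
  let l : Fin n → ℝ := fun i => F (Pi.single i 1)
  have hFl : ∀ x : Fin n → ℝ, F x = ∑ i, l i * x i := by
    intro x
    have hx : x = ∑ i, x i • (Pi.single i 1 : Fin n → ℝ) := by
      ext k
      simp [Finset.sum_apply, Pi.single_apply]
    conv_lhs => rw [hx]
    simp only [map_sum, map_smul, smul_eq_mul, l]
    exact Finset.sum_congr rfl fun i _ => mul_comm _ _
  let G : Fin m → X → ℝ := fun j t => ∑ i, l i * g i j t
  have hGc : ∀ j, Continuous (G j) := fun j =>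
    continuous_finsetSum _ fun i _ => continuous_const.mul (hg i j)
  have hval : ∀ u, f (S u) = ∑ j, ∫ t, G j t * u j t ∂ν := by
    intro u
    rw [hF', hFl]
    have : ∀ i, ((S u : V) : Fin n → ℝ) i = ∑ j, ∫ t, g i j t * u j t ∂ν := hT u
    simp only [this, Finset.mul_sum]
    rw [Finset.sum_comm]
    refine Finset.sum_congr rfl fun j _ => ?_
    simp only [G, Finset.sum_mul, mul_assoc]
    rw [integral_finsetSum _ fun i _ =>
      (aux_int_s3 ν (g i j) (hg i j) (u j) (L1.integrable_coeFn _)).const_mul (l i)]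
    simp only [integral_const_mul]
  set H := f ⟨h, hh⟩ with hH
  have hB : ∀ u ∈ B, ∑ j, ∫ t, G j t * u j t ∂ν < H := fun u hu => by
    rw [← hval]; exact hf _ ⟨u, hu, rfl⟩
  have hH0 : 0 < H := by
    have := hf _ ⟨0, by simpa [B] using hr0, rfl⟩
    simpa using this
  have hsing : ∀ j (v : Lp ℝ 1 ν), ‖v‖ < r → ∫ t, G j t * v t ∂ν < H := by
    intro j v hv
    have hs : ∀ k, k ≠ j → (Pi.single j v : Fin m → Lp ℝ 1 ν) k = 0 := fun k hk =>
      by simp [hk]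
    have h1 := hB (Pi.single j v) (by
      change ∑ k, ‖(Pi.single j v : Fin m → Lp ℝ 1 ν) k‖ < r
      rw [Finset.sum_eq_single j (fun k _ hk => by rw [hs k hk, norm_zero]) (by simp)]
      simpa using hv)
    rw [Finset.sum_eq_single j _ (by simp)] at h1
    · simpa using h1
    · intro k _ hk
      rw [hs k hk]
      rw [integral_eq_zero_of_ae]
      filter_upwards [Lp.coeFn_zero ℝ 1 ν] with t ht
      rw [ht]; simp
  have hGb : ∀ j t, |G j t| ≤ H / r := by
    intro j t
    rw [le_div_iff₀ hr0, mul_comm]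
    have h1 := aux_bump ν (G j) (hGc j) r H hr0 hH0 (hsing j) t
    have h2 := aux_bump ν (fun t => - G j t) (hGc j).neg r H hr0 hH0 (by
      intro v hv
      have := hsing j (-v) (by simpa using hv)
      refine lt_of_eq_of_lt (integral_congr_ae ?_) this
      filter_upwards [Lp.coeFn_neg v] with t ht
      rw [ht]; simp) t
    rcases abs_cases (G j t) with ⟨e, -⟩ | ⟨e, -⟩ <;> rw [e]
    · exact h1
    · exact h2
  have hfin : H ≤ H / r * tvn μ := by
    have h1 : H = ∑ j, sigInt (G j) (μ j) := by
      rw [hH, hF', hFl]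
      simp only [← hμ, bra, Finset.mul_sum]
      rw [Finset.sum_comm]
      exact Finset.sum_congr rfl fun j _ => (aux_sig_sum (fun i => g i j) (fun i => hg i j) l _).symm
    calc H = _ := h1
      _ ≤ ∑ j, H / r * ((μ j).totalVariation Set.univ).toReal :=
        Finset.sum_le_sum fun j _ => aux_sig _ _ (hGb j) _
      _ = _ := by rw [tvn, Finset.mul_sum]
  have : H / r * tvn μ < H / r * r := mul_lt_mul_of_pos_left hr (div_pos hH0 hr0)
  rw [div_mul_cancel₀ _ hr0.ne'] at this
  linarith

end Aux

lemma aux_finite {a b : ℝ} : IsFiniteMeasure (volume : Measure (Set.Icc a b)) := by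
  constructor
  rw [Measure.Subtype.volume_univ measurableSet_Icc.nullMeasurableSet]
  exact measure_Icc_lt_top

/-- Given L¹-feasibility of the constraints, for every feasible measure `μ` and
every `ε > 0` there is an L¹ control `u_ε` satisfying the constraints exactly, with
L¹-norm at most `‖μ‖_TV + ε`. -/
theorem stmt3 {m n : ℕ} {a b : ℝ} (hab : a < b)
    (g : Fin n → Fin m → Set.Icc a b → ℝ) (hg : ∀ i j, Continuous (g i j))
    (h : Fin n → ℝ)
    (u0 : Fin m → Set.Icc a b → ℝ) (hu0int : ∀ j, Integrable (u0 j))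
    (hu0con : ∀ i, ∑ j, ∫ t, g i j t * u0 j t = h i) :
    ∀ μ : Fin m → SignedMeasure (Set.Icc a b), (∀ i, bra (g i) μ = h i) →
      ∀ ε : ℝ, 0 < ε →
        ∃ uε : Fin m → Set.Icc a b → ℝ,
          (∀ j, Integrable (uε j)) ∧
          (∀ i, ∑ j, ∫ t, g i j t * uε j t = h i) ∧
          ∑ j, ∫ t, |uε j t| ≤ tvn μ + ε := by
  intro μ hμ ε hε
  haveI := aux_openPos hab
  haveI : IsFiniteMeasure (volume : Measure (Set.Icc a b)) := aux_finite
  obtain ⟨u, hu1, hu2⟩ := aux_main volume g hg h u0 hu0int hu0con μ hμ (tvn μ + ε) (by linarith)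
  refine ⟨fun j => u j, fun j => L1.integrable_coeFn _, hu1, ?_⟩
  refine le_of_eq_of_le (Finset.sum_congr rfl fun j _ => ?_) hu2.le
  rw [L1.norm_eq_integral_norm]
  rfl
end

section
/- The set R := { ( Σ_{j=1}^m (μ⁺_j([a,b]) + μ⁻_j([a,b])), (⟨g_1, μ⁺⟩ − ⟨g_1, μ⁻⟩, …, ⟨g_n, μ⁺⟩ − ⟨g_n, μ⁻⟩) ) : μ⁺, μ⁻ are m-vectors of finite nonnegative Borel measures on [a,b] } is a closed subset of ℝ × ℝ^n. -/
open MeasureTheory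

/-- The set of vectors `(Σ_j (μ⁺_j([a,b]) + μ⁻_j([a,b])), (⟨g_i,μ⁺⟩ − ⟨g_i,μ⁻⟩)_i)`,
as `μ⁺, μ⁻` range over m-vectors of finite nonnegative Borel measures on `[a,b]`, is a
closed subset of `ℝ × ℝ^n`. -/
theorem stmt4 {m n : ℕ} {a b : ℝ} (hab : a < b)
    (g : Fin n → Fin m → Set.Icc a b → ℝ) (hg : ∀ i j, Continuous (g i j)) :
    IsClosed {p : ℝ × (Fin n → ℝ) |
      ∃ μp μm : Fin m → MeasureTheory.Measure (Set.Icc a b),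
        (∀ j, IsFiniteMeasure (μp j)) ∧ (∀ j, IsFiniteMeasure (μm j)) ∧
        p.1 = ∑ j, ((μp j Set.univ).toReal + (μm j Set.univ).toReal) ∧
        (∀ i, p.2 i = (∑ j, ∫ t, g i j t ∂(μp j)) - ∑ j, ∫ t, g i j t ∂(μm j))} := by
  let X := Fin m → FiniteMeasure (Set.Icc a b)
  let F : X × X → ℝ × (Fin n → ℝ) := fun q =>
    (∑ j, (((q.1 j).mass : ℝ) + ((q.2 j).mass : ℝ)),
      fun i => (∑ j, ∫ t, g i j t ∂(q.1 j : Measure (Set.Icc a b)))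
        - ∑ j, ∫ t, g i j t ∂(q.2 j : Measure (Set.Icc a b)))
  have hint : ∀ i j, Continuous fun ν : FiniteMeasure (Set.Icc a b) =>
      ∫ t, g i j t ∂(ν : Measure (Set.Icc a b)) := by
    intro i j
    exact FiniteMeasure.continuous_integral_boundedContinuousFunction
      (BoundedContinuousFunction.mkOfCompact ⟨g i j, hg i j⟩)
  have hmass : Continuous fun ν : FiniteMeasure (Set.Icc a b) => (ν.mass : ℝ) :=
    NNReal.continuous_coe.comp FiniteMeasure.continuous_mass
  have hF : Continuous F := by
    refine Continuous.prodMk ?_ (continuous_pi fun i => Continuous.sub ?_ ?_)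
    · refine continuous_finsetSum _ fun j _ => Continuous.add ?_ ?_
      · exact hmass.comp ((continuous_apply j).comp continuous_fst)
      · exact hmass.comp ((continuous_apply j).comp continuous_snd)
    · exact continuous_finsetSum _ fun j _ =>
        (hint i j).comp ((continuous_apply j).comp continuous_fst)
    · exact continuous_finsetSum _ fun j _ =>
        (hint i j).comp ((continuous_apply j).comp continuous_snd)
  refine isClosed_of_closure_subset fun p hp => ?_
  let C : NNReal := Real.toNNReal (p.1 + 1)
  let K1 : Set X := Set.univ.pi fun _ => {ν : FiniteMeasure (Set.Icc a b) | ν.mass ≤ C}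
  have hK1 : IsCompact K1 := isCompact_univ_pi fun _ =>
    isCompact_setOfPred_finiteMeasure_le_of_compactSpace (Set.Icc a b) C
  have hcl : IsClosed (F '' (K1 ×ˢ K1)) := ((hK1.prod hK1).image hF).isClosed
  have hU : IsOpen {q : ℝ × (Fin n → ℝ) | q.1 < p.1 + 1} :=
    isOpen_lt continuous_fst continuous_const
  have hp2 := hU.inter_closure ⟨(by simp : p.1 < p.1 + 1), hp⟩
  have hmem : p ∈ F '' (K1 ×ˢ K1) := by
    refine closure_minimal ?_ hcl hp2
    rintro q ⟨hq, μp, μm, h1, h2, h3, h4⟩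
    have hq' : q.1 < p.1 + 1 := hq
    have key : ∀ j, (μp j Set.univ).toReal + (μm j Set.univ).toReal ≤ p.1 + 1 := by
      intro j
      have := Finset.single_le_sum (f := fun j => (μp j Set.univ).toReal + (μm j Set.univ).toReal)
        (fun i _ => by positivity) (Finset.mem_univ j)
      linarith
    refine ⟨(fun j => ⟨μp j, h1 j⟩, fun j => ⟨μm j, h2 j⟩), ⟨?_, ?_⟩, ?_⟩
    · intro j _
      refine NNReal.coe_le_coe.1 (le_trans ?_ (Real.le_coe_toNNReal _))
      exact le_trans (le_add_of_nonneg_right ENNReal.toReal_nonneg) (key j)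
    · intro j _
      refine NNReal.coe_le_coe.1 (le_trans ?_ (Real.le_coe_toNNReal _))
      exact le_trans (le_add_of_nonneg_left ENNReal.toReal_nonneg) (key j)
    · exact Prod.ext h3.symm (funext fun i => (h4 i).symm)
  obtain ⟨q, -, rfl⟩ := hmem
  exact ⟨fun j => q.1 j, fun j => q.2 j, fun j => inferInstance, fun j => inferInstance,
    rfl, fun i => rfl⟩
end

section
/- Suppose there exist m-vectors μ⁺, μ⁻ of finite nonnegative Borel measures on [a,b] with ⟨g_i, μ⁺⟩ − ⟨g_i, μ⁻⟩ = h_i for all i = 1,…,n. Then strong duality holds: p* = d*, where p* := inf { Σ_{j=1}^m (μ⁺_j([a,b]) + μ⁻_j([a,b])) : μ⁺, μ⁻ nonnegative, ⟨g_i, μ⁺⟩ − ⟨g_i, μ⁻⟩ = h_i for all i } and d* := sup { Σ_{i=1}^n y_i h_i : y ∈ ℝ^n such that |Σ_{i=1}^n y_i g_{i,j}(t)| ≤ 1 for all t ∈ [a,b] and all j = 1,…,m }. -/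
open MeasureTheory

lemma abs_dual {E : Type*} [AddCommGroup E] [Module ℝ E] (S : E → ℝ → Prop)
    (h0 : S 0 0) (hadd : ∀ x y r q, S x r → S y q → S (x + y) (r + q))
    (hsmul : ∀ (c : ℝ) x r, 0 < c → S x r → S (c • x) (c * r))
    (hneg : ∀ x r, S x r → S (-x) r) (hnn : ∀ x r, S x r → 0 ≤ r)
    (h : E) (r0 : ℝ) (hr0 : S h r0) :
    ∃ f : E →ₗ[ℝ] ℝ, f h = sInf {r | S h r} ∧ ∀ x r, S x r → f x ≤ r := by
  have hbdd : ∀ x, BddBelow {r | S x r} := fun x => ⟨0, fun r hr => hnn x r hr⟩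
  have hpnn : ∀ x, 0 ≤ sInf {r | S x r} := fun x => Real.sInf_nonneg (fun r hr => hnn x r hr)
  have hple : ∀ x r, S x r → sInf {r | S x r} ≤ r := fun x r hr => csInf_le (hbdd x) hr
  have hp0 : sInf {r | S (0 : E) r} = 0 := le_antisymm (hple 0 0 h0) (hpnn 0)
  by_cases hh : h = 0
  · subst hh
    exact ⟨0, by simp [hp0], fun x r hr => by simpa using hnn x r hr⟩
  let V : Submodule ℝ E :=
    { carrier := {x | ∃ r, S x r}
      add_mem' := by
        rintro x y ⟨r, hr⟩ ⟨q, hq⟩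
        exact ⟨_, hadd _ _ _ _ hr hq⟩
      zero_mem' := ⟨0, h0⟩
      smul_mem' := by
        rintro c x ⟨r, hr⟩
        rcases lt_trichotomy c 0 with hc | hc | hc
        · refine ⟨(-c) * r, ?_⟩
          have := hneg _ _ (hsmul (-c) x r (by linarith) hr)
          simpa using this
        · subst hc
          exact ⟨0, by simpa using h0⟩
        · exact ⟨_, hsmul c x r hc hr⟩ }
  let N : V → ℝ := fun x => sInf {r | S (x : E) r}
  have hne : ∀ x : V, {r | S (x : E) r}.Nonempty := fun x => x.2
  have hom_le : ∀ c : ℝ, 0 < c → ∀ x : V, N (c • x) ≤ c * N x := by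
    intro c hc x
    rw [← div_le_iff₀' hc]
    refine le_csInf (hne x) ?_
    intro r hr
    rw [div_le_iff₀' hc]
    exact hple _ _ (hsmul c x r hc hr)
  have hom : ∀ c : ℝ, 0 < c → ∀ x : V, N (c • x) = c * N x := by
    intro c hc x
    refine le_antisymm (hom_le c hc x) ?_
    have := hom_le c⁻¹ (inv_pos.2 hc) (c • x)
    rw [inv_smul_smul₀ hc.ne'] at this
    rwa [inv_mul_eq_div, le_div_iff₀' hc] at this
  have hNadd : ∀ x y : V, N (x + y) ≤ N x + N y := by
    intro x y
    have h1 : ∀ r, S (x : E) r → N (x + y) - r ≤ N y := by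
      intro r hr
      refine le_csInf (hne y) ?_
      intro q hq
      have := hple _ _ (hadd _ _ _ _ hr hq)
      change sInf _ - r ≤ q
      rw [Submodule.coe_add]
      linarith
    have h2 : N (x + y) - N y ≤ N x := by
      refine le_csInf (hne x) ?_
      intro r hr
      have := h1 r hr
      linarith
    linarith
  let hV : V := ⟨h, r0, hr0⟩
  have hV0 : hV ≠ 0 := fun H => hh (congrArg Subtype.val H)
  obtain ⟨f, hf1, hf2⟩ := exists_extension_of_le_sublinear
    (LinearPMap.mkSpanSingleton (K := ℝ) hV (N hV) hV0) N hom hNadd (by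
      rintro ⟨x, hx⟩
      obtain ⟨c, rfl⟩ := Submodule.mem_span_singleton.1 hx
      erw [LinearPMap.mkSpanSingleton'_apply]
      rcases le_or_gt c 0 with hc | hc
      · exact le_trans (mul_nonpos_of_nonpos_of_nonneg hc (hpnn _)) (hpnn _)
      · rw [hom c hc]; simp)
  obtain ⟨F, hF⟩ := LinearMap.exists_extend f
  have hFv : ∀ v : V, F v = f v := fun v => by rw [← hF]; rfl
  refine ⟨F, ?_, ?_⟩
  · have h1 := hf1 ⟨hV, Submodule.mem_span_singleton_self hV⟩
    rw [LinearPMap.mkSpanSingleton_apply] at h1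
    exact (hFv hV).trans h1
  · intro x r hr
    exact (hFv ⟨x, r, hr⟩).trans_le ((hf2 _).trans (hple _ _ hr))

/-- Strong duality between the primal LP on pairs of nonnegative vector measures
and the dual LP over `y ∈ ℝ^n` with `|Σ_i y_i g_{i,j}(t)| ≤ 1`, assuming primal feasibility. -/
theorem stmt5 {m n : ℕ} {a b : ℝ} (hab : a < b)
    (g : Fin n → Fin m → Set.Icc a b → ℝ) (hg : ∀ i j, Continuous (g i j))
    (h : Fin n → ℝ)
    (hfeas : ∃ μp μm : Fin m → MeasureTheory.Measure (Set.Icc a b),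
      (∀ j, IsFiniteMeasure (μp j)) ∧ (∀ j, IsFiniteMeasure (μm j)) ∧
      (∀ i, (∑ j, ∫ t, g i j t ∂(μp j)) - (∑ j, ∫ t, g i j t ∂(μm j)) = h i)) :
    sInf {r : ℝ | ∃ μp μm : Fin m → MeasureTheory.Measure (Set.Icc a b),
        (∀ j, IsFiniteMeasure (μp j)) ∧ (∀ j, IsFiniteMeasure (μm j)) ∧
        (∀ i, (∑ j, ∫ t, g i j t ∂(μp j)) - (∑ j, ∫ t, g i j t ∂(μm j)) = h i) ∧
        r = ∑ j, ((μp j Set.univ).toReal + (μm j Set.univ).toReal)} =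
    sSup {r : ℝ | ∃ y : Fin n → ℝ,
        (∀ t : Set.Icc a b, ∀ j, |∑ i, y i * g i j t| ≤ 1) ∧
        r = ∑ i, y i * h i} := by
  classical
  have hint : ∀ i j (μ : Measure (Set.Icc a b)), IsFiniteMeasure μ → Integrable (g i j) μ := by
    intro i j μ _
    exact (hg i j).integrable_of_hasCompactSupport (HasCompactSupport.of_compactSpace _)
  let S : (Fin n → ℝ) → ℝ → Prop := fun x r =>
    ∃ μp μm : Fin m → MeasureTheory.Measure (Set.Icc a b),
        (∀ j, IsFiniteMeasure (μp j)) ∧ (∀ j, IsFiniteMeasure (μm j)) ∧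
        (∀ i, (∑ j, ∫ t, g i j t ∂(μp j)) - (∑ j, ∫ t, g i j t ∂(μm j)) = x i) ∧
        r = ∑ j, ((μp j Set.univ).toReal + (μm j Set.univ).toReal)
  obtain ⟨μp0, μm0, hp0, hm0, he0⟩ := hfeas
  have hr0 : S h _ := ⟨μp0, μm0, hp0, hm0, he0, rfl⟩
  have weak : ∀ (y : Fin n → ℝ), (∀ t : Set.Icc a b, ∀ j, |∑ i, y i * g i j t| ≤ 1) →
      ∀ x r, S x r → ∑ i, y i * x i ≤ r := by
    rintro y hy x r ⟨μp, μm, hp, hm, he, rfl⟩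
    have key : ∀ j (μ : Measure (Set.Icc a b)), IsFiniteMeasure μ →
        |∑ i, y i * ∫ t, g i j t ∂μ| ≤ (μ Set.univ).toReal := by
      intro j μ hμ
      have h1 : ∑ i, y i * ∫ t, g i j t ∂μ = ∫ t, ∑ i, y i * g i j t ∂μ := by
        rw [integral_finsetSum _ (fun i _ => (hint i j μ hμ).const_mul _)]
        simp [integral_const_mul]
      rw [h1]
      have := norm_integral_le_of_norm_le_const (μ := μ) (C := 1)
        (f := fun t => ∑ i, y i * g i j t) (Filter.Eventually.of_forall fun t => hy t j)
      simpa [Measure.real] using this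
    have h2 : ∑ i, y i * x i = ∑ j, ((∑ i, y i * ∫ t, g i j t ∂(μp j))
        - ∑ i, y i * ∫ t, g i j t ∂(μm j)) := by
      simp_rw [← he, mul_sub, Finset.sum_sub_distrib, Finset.mul_sum]
      congr 1 <;> exact Finset.sum_comm
    rw [h2]
    refine Finset.sum_le_sum fun j _ => ?_
    have ha := abs_le.1 (key j _ (hp j))
    have hb := abs_le.1 (key j _ (hm j))
    linarith [ha.2, hb.1]
  obtain ⟨f, hf1, hf2⟩ := abs_dual S
    (by
      refine ⟨fun _ => 0, fun _ => 0, fun _ => inferInstance, fun _ => inferInstance, ?_, ?_⟩ <;>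
        simp)
    (by
      rintro x y r q ⟨μp, μm, hp, hm, he, rfl⟩ ⟨νp, νm, hp', hm', he', rfl⟩
      refine ⟨fun j => μp j + νp j, fun j => μm j + νm j, fun _ => inferInstance,
        fun _ => inferInstance, ?_, ?_⟩
      · intro i
        simp_rw [fun j => integral_add_measure (hint i j _ (hp j)) (hint i j _ (hp' j)),
          fun j => integral_add_measure (hint i j _ (hm j)) (hint i j _ (hm' j)),
          Finset.sum_add_distrib, Pi.add_apply, ← he, ← he']
        ring
      · rw [← Finset.sum_add_distrib]
        refine Finset.sum_congr rfl fun j _ => ?_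
        rw [Measure.add_apply, Measure.add_apply, ENNReal.toReal_add (by simp) (by simp),
          ENNReal.toReal_add (by simp) (by simp)]
        ring)
    (by
      rintro c x r hc ⟨μp, μm, hp, hm, he, rfl⟩
      refine ⟨fun j => ENNReal.ofReal c • μp j, fun j => ENNReal.ofReal c • μm j,
        fun j => (μp j).smul_finite ENNReal.ofReal_ne_top,
        fun j => (μm j).smul_finite ENNReal.ofReal_ne_top, ?_, ?_⟩
      · intro i
        simp_rw [integral_smul_measure, ENNReal.toReal_ofReal hc.le, Pi.smul_apply, ← he,
          smul_eq_mul, ← Finset.mul_sum]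
        ring
      · rw [Finset.mul_sum]
        refine Finset.sum_congr rfl fun j _ => ?_
        simp [ENNReal.toReal_ofReal hc.le]
        ring)
    (by
      rintro x r ⟨μp, μm, hp, hm, he, rfl⟩
      refine ⟨μm, μp, hm, hp, ?_, ?_⟩
      · intro i
        rw [Pi.neg_apply, ← he]
        ring
      · exact Finset.sum_congr rfl fun j _ => add_comm _ _)
    (by
      rintro x r ⟨μp, μm, hp, hm, he, rfl⟩
      positivity)
    h _ hr0
  have hfy : ∀ x : Fin n → ℝ, f x = ∑ i, f (Pi.single i 1) * x i := by
    intro x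
    rw [LinearMap.pi_apply_eq_sum_univ f x]
    refine Finset.sum_congr rfl fun i _ => ?_
    rw [smul_eq_mul, mul_comm]
    congr 2
    ext k
    simp [Pi.single_apply, eq_comm]
  have hdir : ∀ (t : Set.Icc a b) j, S (fun i => g i j t) 1 := by
    intro t j
    refine ⟨fun k => if k = j then Measure.dirac t else 0, fun _ => 0, ?_,
      fun _ => inferInstance, ?_, ?_⟩
    · intro k
      dsimp only
      split_ifs <;> infer_instance
    · intro i
      rw [Finset.sum_eq_single j]
      · simp
      · intro k _ hk
        simp [hk]
      · simp
    · rw [Finset.sum_eq_single j]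
      · simp
      · intro k _ hk
        simp [hk]
      · simp
  have hdual : ∀ t : Set.Icc a b, ∀ j, |∑ i, f (Pi.single i 1) * g i j t| ≤ 1 := by
    intro t j
    rw [← hfy (fun i => g i j t), abs_le]
    refine ⟨?_, hf2 _ _ (hdir t j)⟩
    have h3 : S (-(fun i => g i j t)) 1 := by
      obtain ⟨μp, μm, hp, hm, he, hr⟩ := hdir t j
      refine ⟨μm, μp, hm, hp, ?_, ?_⟩
      · intro i
        have h4 := he i
        simp only [Pi.neg_apply] at h4 ⊢
        linarith
      · rw [hr]
        exact Finset.sum_congr rfl fun j _ => add_comm _ _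
    have := hf2 _ _ h3
    rw [map_neg] at this
    linarith
  change sInf {r | S h r} = _
  refine le_antisymm ?_ ?_
  · refine le_csSup ⟨∑ j, ((μp0 j Set.univ).toReal + (μm0 j Set.univ).toReal), ?_⟩ ⟨fun i => f (Pi.single i 1), hdual, ?_⟩
    · rintro r ⟨y, hy, rfl⟩
      exact weak y hy _ _ hr0
    · rw [← hf1, hfy]
  · refine csSup_le ⟨_, fun i => f (Pi.single i 1), hdual, rfl⟩ ?_
    rintro r ⟨y, hy, rfl⟩
    exact le_csInf ⟨_, hr0⟩ fun q hq => weak y hy _ _ hq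
end

section
/- Suppose μ⁺, μ⁻ are m-vectors of finite nonnegative Borel measures on [a,b] satisfying ⟨g_i, μ⁺⟩ − ⟨g_i, μ⁻⟩ = h_i for all i, suppose y ∈ ℝ^n satisfies |Σ_{i=1}^n y_i g_{i,j}(t)| ≤ 1 for all t ∈ [a,b] and j = 1,…,m, and suppose the complementary values coincide: Σ_{j=1}^m (μ⁺_j([a,b]) + μ⁻_j([a,b])) = Σ_{i=1}^n y_i h_i. Then for each j = 1,…,m, the measure μ⁺_j is concentrated on the set {t ∈ [a,b] : Σ_{i=1}^n y_i g_{i,j}(t) = 1} (i.e., μ⁺_j of the complement of this set is zero), and μ⁻_j is concentrated on the set {t ∈ [a,b] : Σ_{i=1}^n y_i g_{i,j}(t) = −1}. -/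
open MeasureTheory

/-- Complementary slackness: if a primal-feasible pair `(μ⁺, μ⁻)` and a
dual-feasible `y` have equal objective values, then each `μ⁺_j` is concentrated on
`{t : Σ_i y_i g_{i,j}(t) = 1}` and each `μ⁻_j` on `{t : Σ_i y_i g_{i,j}(t) = −1}`. -/
theorem stmt7 {m n : ℕ} {a b : ℝ} (hab : a < b)
    (g : Fin n → Fin m → Set.Icc a b → ℝ) (hg : ∀ i j, Continuous (g i j))
    (h : Fin n → ℝ)
    (μp μm : Fin m → MeasureTheory.Measure (Set.Icc a b))
    (hμp : ∀ j, IsFiniteMeasure (μp j)) (hμm : ∀ j, IsFiniteMeasure (μm j))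
    (hcon : ∀ i, (∑ j, ∫ t, g i j t ∂(μp j)) - (∑ j, ∫ t, g i j t ∂(μm j)) = h i)
    (y : Fin n → ℝ)
    (hy : ∀ t : Set.Icc a b, ∀ j, |∑ i, y i * g i j t| ≤ 1)
    (heq : ∑ j, ((μp j Set.univ).toReal + (μm j Set.univ).toReal) = ∑ i, y i * h i) :
    ∀ j,
      μp j {t : Set.Icc a b | ∑ i, y i * g i j t = 1}ᶜ = 0 ∧
      μm j {t : Set.Icc a b | ∑ i, y i * g i j t = -1}ᶜ = 0 := by
  have hint : ∀ (ν : Fin m → Measure (Set.Icc a b)), (∀ j, IsFiniteMeasure (ν j)) →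
      ∀ i j, Integrable (g i j) (ν j) := by
    intro ν hν i j
    have := hν j
    have h1 := (hg i j).continuousOn.integrableOn_compact (μ := ν j) (isCompact_univ)
    simpa using h1
  have hsum : ∀ (ν : Fin m → Measure (Set.Icc a b)), (∀ j, IsFiniteMeasure (ν j)) →
      ∑ i, y i * ∑ j, ∫ t, g i j t ∂(ν j) = ∑ j, ∫ t, (∑ i, y i * g i j t) ∂(ν j) := by
    intro ν hν
    simp_rw [Finset.mul_sum]
    rw [Finset.sum_comm]
    refine Finset.sum_congr rfl fun j _ => ?_
    rw [integral_finsetSum _ (fun i _ => (hint ν hν i j).const_mul (y i))]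
    simp_rw [integral_const_mul]
  have hI : ∀ (ν : Fin m → Measure (Set.Icc a b)), (∀ j, IsFiniteMeasure (ν j)) →
      ∀ j, Integrable (fun t => ∑ i, y i * g i j t) (ν j) := fun ν hν j =>
    integrable_finsetSum _ (fun i _ => (hint ν hν i j).const_mul (y i))
  have hP : ∀ j, ∫ t, (1 - ∑ i, y i * g i j t) ∂(μp j)
      = (μp j Set.univ).toReal - ∫ t, (∑ i, y i * g i j t) ∂(μp j) := by
    intro j
    have := hμp j
    rw [integral_sub (integrable_const _) (hI μp hμp j)]
    simp [Measure.real]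
  have hM : ∀ j, ∫ t, (1 + ∑ i, y i * g i j t) ∂(μm j)
      = (μm j Set.univ).toReal + ∫ t, (∑ i, y i * g i j t) ∂(μm j) := by
    intro j
    have := hμm j
    rw [integral_add (integrable_const _) (hI μm hμm j)]
    simp [Measure.real]
  have hP0 : ∀ j, 0 ≤ ∫ t, (1 - ∑ i, y i * g i j t) ∂(μp j) := fun j =>
    integral_nonneg fun t => by have := abs_le.1 (hy t j); simp only [Pi.zero_apply]; linarith
  have hM0 : ∀ j, 0 ≤ ∫ t, (1 + ∑ i, y i * g i j t) ∂(μm j) := fun j =>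
    integral_nonneg fun t => by have := abs_le.1 (hy t j); simp only [Pi.zero_apply]; linarith
  have htot : ∑ j, (∫ t, (1 - ∑ i, y i * g i j t) ∂(μp j)
      + ∫ t, (1 + ∑ i, y i * g i j t) ∂(μm j)) = 0 := by
    simp_rw [hP, hM]
    simp_rw [← hcon, mul_sub] at heq
    rw [Finset.sum_sub_distrib, hsum μp hμp, hsum μm hμm] at heq
    simp only [Finset.sum_add_distrib, Finset.sum_sub_distrib] at heq ⊢
    linarith
  have hz := (Finset.sum_eq_zero_iff_of_nonneg (fun j _ => add_nonneg (hP0 j) (hM0 j))).1 htot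
  intro j
  have hj := hz j (Finset.mem_univ j)
  have := hμp j
  have := hμm j
  have e1 : ∫ t, (1 - ∑ i, y i * g i j t) ∂(μp j) = 0 := by linarith [hP0 j, hM0 j]
  have e2 : ∫ t, (1 + ∑ i, y i * g i j t) ∂(μm j) = 0 := by linarith [hP0 j, hM0 j]
  rw [integral_eq_zero_iff_of_nonneg (f := fun t => 1 - ∑ i, y i * g i j t)
    (fun t => by have := abs_le.1 (hy t j); simp only [Pi.zero_apply]; linarith)
    ((integrable_const _).sub (hI μp hμp j))] at e1
  rw [integral_eq_zero_iff_of_nonneg (f := fun t => 1 + ∑ i, y i * g i j t)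
    (fun t => by have := abs_le.1 (hy t j); simp only [Pi.zero_apply]; linarith)
    ((integrable_const _).add (hI μm hμm j))] at e2
  constructor
  · change ∀ᵐ t ∂(μp j), ∑ i, y i * g i j t = 1
    filter_upwards [e1] with t ht
    simp only [Pi.zero_apply] at ht
    linarith
  · change ∀ᵐ t ∂(μm j), ∑ i, y i * g i j t = -1
    filter_upwards [e2] with t ht
    simp only [Pi.zero_apply] at ht
    linarith
end

section
/- Fix c ≥ 0 and suppose the exact moment problem is feasible (there exists μ with ⟨g_i, μ⟩ = h_i for all i), with optimal value p*. For e > 0 define the relaxed value p_e := inf { ‖μ‖_TV : μ ∈ M([a,b]; ℝ^m), |⟨g_i, μ⟩ − h_i| ≤ e·(c + ‖μ‖_TV) for all i = 1,…,n }. Then p_e ≤ p* for every e > 0, and p_e → p* as e → 0⁺. -/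
open MeasureTheory

attribute [local instance] MeasureTheory.Measure.Subtype.measureSpace

open Filter

theorem sigInt_add' {X : Type*} [MeasurableSpace X] (f : X → ℝ)
    (hf : ∀ P : Measure X, IsFiniteMeasure P → Integrable f P) (μ ν : SignedMeasure X) :
    sigInt f (μ + ν) = sigInt f μ + sigInt f ν := by
  have key : (μ + ν).toJordanDecomposition.posPart + (μ.toJordanDecomposition.negPart
      + ν.toJordanDecomposition.negPart) = (μ + ν).toJordanDecomposition.negPart +
      (μ.toJordanDecomposition.posPart + ν.toJordanDecomposition.posPart) := by
    ext s hs
    have h1 := SignedMeasure.apply_eq_posPart_real_sub_negPart_real (μ + ν) hs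
    have h2 := SignedMeasure.apply_eq_posPart_real_sub_negPart_real μ hs
    have h3 := SignedMeasure.apply_eq_posPart_real_sub_negPart_real ν hs
    have h4 : (μ + ν) s = μ s + ν s := rfl
    refine (measureReal_eq_measureReal_iff).1 ?_
    rw [measureReal_add_apply, measureReal_add_apply, measureReal_add_apply,
      measureReal_add_apply]
    linarith
  have h5 := congrArg (fun P => ∫ t, f t ∂P) key
  rw [integral_add_measure (hf _ inferInstance) (hf _ inferInstance),
    integral_add_measure (hf _ inferInstance) (hf _ inferInstance),
    integral_add_measure (hf _ inferInstance) (hf _ inferInstance),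
    integral_add_measure (hf _ inferInstance) (hf _ inferInstance)] at h5
  unfold sigInt
  linarith

theorem sigInt_smul' {X : Type*} [MeasurableSpace X] (f : X → ℝ) (r : ℝ) (μ : SignedMeasure X) :
    sigInt f (r • μ) = r * sigInt f μ := by
  unfold sigInt
  rw [SignedMeasure.toJordanDecomposition_smul_real]
  rcases le_or_gt 0 r with hr | hr
  · rw [JordanDecomposition.real_smul_posPart_nonneg _ _ hr,
      JordanDecomposition.real_smul_negPart_nonneg _ _ hr]
    simp only [integral_smul_nnreal_measure, NNReal.smul_def, Real.coe_toNNReal _ hr, smul_eq_mul]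
    ring
  · rw [JordanDecomposition.real_smul_posPart_neg _ _ hr,
      JordanDecomposition.real_smul_negPart_neg _ _ hr]
    simp only [integral_smul_nnreal_measure, NNReal.smul_def,
      Real.coe_toNNReal _ (neg_nonneg.2 hr.le), smul_eq_mul]
    ring

theorem tv_ne_top' {X : Type*} [MeasurableSpace X] (μ : SignedMeasure X) :
    μ.totalVariation Set.univ ≠ ⊤ := by
  unfold SignedMeasure.totalVariation
  exact measure_ne_top _ _

theorem tvn_nonneg' {X : Type*} [MeasurableSpace X] {m : ℕ} (μ : Fin m → SignedMeasure X) :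
    0 ≤ tvn μ := Finset.sum_nonneg fun _ _ => ENNReal.toReal_nonneg

theorem tvn_add' {X : Type*} [MeasurableSpace X] {m : ℕ} (μ ν : Fin m → SignedMeasure X) :
    tvn (μ + ν) ≤ tvn μ + tvn ν := by
  unfold tvn
  rw [← Finset.sum_add_distrib]
  refine Finset.sum_le_sum fun j _ => ?_
  rw [← ENNReal.toReal_add (tv_ne_top' _) (tv_ne_top' _)]
  refine ENNReal.toReal_mono (ENNReal.add_ne_top.2 ⟨tv_ne_top' _, tv_ne_top' _⟩) ?_
  simp only [SignedMeasure.totalVariation_eq_variation]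
  exact VectorMeasure.variation_add_le (μ := μ j) (ν := ν j) Set.univ

theorem tvn_smul' {X : Type*} [MeasurableSpace X] {m : ℕ} (r : ℝ) (μ : Fin m → SignedMeasure X) :
    tvn (r • μ) = |r| * tvn μ := by
  unfold tvn
  rw [Finset.mul_sum]
  refine Finset.sum_congr rfl fun j _ => ?_
  simp only [SignedMeasure.totalVariation_eq_variation, Pi.smul_apply]
  rw [VectorMeasure.variation_smul]
  simp

theorem tvn_sum' {X : Type*} [MeasurableSpace X] {m : ℕ} {ι : Type*} (s : Finset ι)
    (μ : ι → Fin m → SignedMeasure X) :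
    tvn (∑ i ∈ s, μ i) ≤ ∑ i ∈ s, tvn (μ i) := by
  classical
  induction s using Finset.induction_on with
  | empty => simp [tvn, SignedMeasure.totalVariation_zero]
  | insert i s hi ih =>
    rw [Finset.sum_insert hi, Finset.sum_insert hi]
    exact (tvn_add' _ _).trans (by linarith)

theorem correction' {X : Type*} [MeasurableSpace X] {m n : ℕ} (g : Fin n → Fin m → X → ℝ)
    (hg : ∀ i j, ∀ P : Measure X, IsFiniteMeasure P → Integrable (g i j) P) :
    ∃ K : ℝ, 0 ≤ K ∧ ∀ (ν μ : Fin m → SignedMeasure X) (d : ℝ),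
      (∀ i, |bra (g i) ν - bra (g i) μ| ≤ d) →
      ∃ ρ : Fin m → SignedMeasure X, (∀ i, bra (g i) ρ = bra (g i) μ) ∧
        tvn ρ ≤ tvn ν + K * d := by
  let T : (Fin m → SignedMeasure X) →ₗ[ℝ] (Fin n → ℝ) :=
    { toFun := fun μ i => bra (g i) μ
      map_add' := by
        intro μ ν
        ext i
        simp only [bra, Pi.add_apply, ← Finset.sum_add_distrib]
        exact Finset.sum_congr rfl fun j _ => sigInt_add' _ (hg i j) _ _
      map_smul' := by
        intro r μ
        ext i
        simp only [bra, Pi.smul_apply, smul_eq_mul, Finset.mul_sum, RingHom.id_apply]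
        exact Finset.sum_congr rfl fun j _ => sigInt_smul' _ _ _ }
  obtain ⟨S₀, hS₀⟩ := T.rangeRestrict.exists_rightInverse_of_surjective T.range_rangeRestrict
  obtain ⟨S, hS⟩ := LinearMap.exists_extend S₀
  have hTS : ∀ μ, T (S (T μ)) = T μ := by
    intro μ
    have h1 : S (T μ) = S₀ (T.rangeRestrict μ) := by
      rw [← hS]; rfl
    rw [h1]
    have h2 := LinearMap.congr_fun hS₀ (T.rangeRestrict μ)
    exact congrArg Subtype.val h2
  refine ⟨∑ i, tvn (S (Pi.single i 1)), Finset.sum_nonneg fun i _ => tvn_nonneg' _, ?_⟩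
  intro ν μ d hd
  refine ⟨ν + S (T (μ - ν)), ?_, ?_⟩
  · have : T (ν + S (T (μ - ν))) = T μ := by
      rw [map_add, hTS, map_sub]; abel
    exact fun i => congrFun this i
  · refine (tvn_add' _ _).trans (add_le_add le_rfl ?_)
    have h3 : T (μ - ν) = ∑ i, (T (μ - ν) i) • (Pi.single i (1 : ℝ) : Fin n → ℝ) := by
      exact pi_eq_sum_univ' _
    rw [h3, map_sum, Finset.sum_mul]
    refine (tvn_sum' _ _).trans (Finset.sum_le_sum fun i _ => ?_)
    rw [map_smul, tvn_smul', mul_comm]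
    refine mul_le_mul_of_nonneg_left ?_ (tvn_nonneg' _)
    have h4 : T (μ - ν) i = bra (g i) μ - bra (g i) ν := by rw [map_sub]; rfl
    rw [h4, abs_sub_comm]
    exact hd i

/-- If the exact moment problem is feasible with value `p*`, then the
relaxed values `p_e` satisfy `p_e ≤ p*` for all `e > 0` and `p_e → p*` as `e → 0⁺`. -/
theorem stmt11 {m n : ℕ} {a b : ℝ} (hab : a < b)
    (g : Fin n → Fin m → Set.Icc a b → ℝ) (hg : ∀ i j, Continuous (g i j))
    (h : Fin n → ℝ) (c : ℝ) (hc : 0 ≤ c)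
    (hfeas : ∃ μ : Fin m → SignedMeasure (Set.Icc a b), ∀ i, bra (g i) μ = h i) :
    (∀ e : ℝ, 0 < e →
      sInf {r : ℝ | ∃ μ : Fin m → SignedMeasure (Set.Icc a b),
          (∀ i, |bra (g i) μ - h i| ≤ e * (c + tvn μ)) ∧ r = tvn μ} ≤
      sInf {r : ℝ | ∃ μ : Fin m → SignedMeasure (Set.Icc a b),
          (∀ i, bra (g i) μ = h i) ∧ r = tvn μ}) ∧
    Tendsto (fun e : ℝ =>
        sInf {r : ℝ | ∃ μ : Fin m → SignedMeasure (Set.Icc a b),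
          (∀ i, |bra (g i) μ - h i| ≤ e * (c + tvn μ)) ∧ r = tvn μ})
      (nhdsWithin 0 (Set.Ioi 0))
      (nhds (sInf {r : ℝ | ∃ μ : Fin m → SignedMeasure (Set.Icc a b),
          (∀ i, bra (g i) μ = h i) ∧ r = tvn μ})) := by
  obtain ⟨μ₀, hμ₀⟩ := hfeas
  have hint : ∀ i j, ∀ P : Measure (Set.Icc a b), IsFiniteMeasure P → Integrable (g i j) P := by
    intro i j P hP
    exact (hg i j).integrable_of_hasCompactSupport (HasCompactSupport.of_compactSpace _)
  obtain ⟨K, hK, hcor⟩ := correction' g hint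
  set p : ℝ := sInf {r : ℝ | ∃ μ : Fin m → SignedMeasure (Set.Icc a b),
          (∀ i, bra (g i) μ = h i) ∧ r = tvn μ} with hp
  set q : ℝ → ℝ := fun e => sInf {r : ℝ | ∃ μ : Fin m → SignedMeasure (Set.Icc a b),
          (∀ i, |bra (g i) μ - h i| ≤ e * (c + tvn μ)) ∧ r = tvn μ} with hq
  have hsub : ∀ e : ℝ, 0 < e → ∀ μ : Fin m → SignedMeasure (Set.Icc a b),
      (∀ i, bra (g i) μ = h i) → ∀ i, |bra (g i) μ - h i| ≤ e * (c + tvn μ) := by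
    intro e he μ hμ i
    rw [hμ i, sub_self, abs_zero]
    exact mul_nonneg he.le (add_nonneg hc (tvn_nonneg' _))
  have h1 : ∀ e : ℝ, 0 < e → q e ≤ p := by
    intro e he
    refine csInf_le_csInf ⟨0, ?_⟩ ⟨_, μ₀, hμ₀, rfl⟩ ?_
    · rintro r ⟨μ, -, rfl⟩
      exact tvn_nonneg' μ
    · rintro r ⟨μ, hμ, rfl⟩
      exact ⟨μ, hsub e he μ hμ, rfl⟩
  have h2 : ∀ e : ℝ, 0 < e → p - K * (e * (c + p + e)) - e ≤ q e := by
    intro e he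
    obtain ⟨r, ⟨ν, hν, rfl⟩, hr⟩ := exists_lt_of_csInf_lt
      (s := {r : ℝ | ∃ μ : Fin m → SignedMeasure (Set.Icc a b),
          (∀ i, |bra (g i) μ - h i| ≤ e * (c + tvn μ)) ∧ r = tvn μ})
      ⟨_, μ₀, hsub e he μ₀ hμ₀, rfl⟩ (show q e < q e + e by linarith)
    have hq1 := h1 e he
    obtain ⟨ρ, hρ, hρ'⟩ := hcor ν μ₀ (e * (c + p + e)) (by
      intro i
      rw [hμ₀ i]
      refine (hν i).trans (mul_le_mul_of_nonneg_left ?_ he.le)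
      linarith)
    have h3 : p ≤ tvn ρ := by
      refine csInf_le ⟨0, ?_⟩ ⟨ρ, fun i => (hρ i).trans (hμ₀ i), rfl⟩
      rintro r ⟨μ, -, rfl⟩
      exact tvn_nonneg' μ
    linarith
  refine ⟨h1, ?_⟩
  have h4 : Tendsto (fun e : ℝ => p - K * (e * (c + p + e)) - e) (nhdsWithin 0 (Set.Ioi 0))
      (nhds p) := by
    have : Continuous (fun e : ℝ => p - K * (e * (c + p + e)) - e) := by fun_prop
    have h5 := (this.tendsto 0).mono_left (nhdsWithin_le_nhds (s := Set.Ioi 0))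
    simpa using h5
  refine tendsto_of_tendsto_of_tendsto_of_le_of_le' h4 tendsto_const_nhds ?_ ?_
  · exact eventually_nhdsWithin_of_forall fun e he => h2 e he
  · exact eventually_nhdsWithin_of_forall fun e he => h1 e he
end
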